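/- arXiv:2601.19177 — 7 statements merged into one kernel-verified Lean document; each statement's English description precedes it below -/
import Mathlib

section
/- There exists an absolute constant C > 0 such that for every real number T > 0, every natural number N ≥ 1, and every sequence of complex numbers a_1, …, a_N, one has ∫_0^T |∑_{n=1}^N a_n n^{it}|^2 dt ≤ C · (T + N) · ∑_{n=1}^N |a_n|^2. -/
open MeasureTheory Complex

/-- The logarithm expands distances on `(0, L]` by a factor of at least `1 / L`. -/
lemma abs_sub_le_mul_abs_log_sub_log {L x y : ℝ} (hx : 0 < x) (hy : 0 < y) (hxL : x ≤ L)
    (hyL : y ≤ L) : |x - y| ≤ L * |Real.log x - Real.log y| := by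
  wlog h : y ≤ x generalizing x y
  · rw [abs_sub_comm, abs_sub_comm (Real.log x)]
    exact this hy hx hyL hxL (le_of_not_ge h)
  have hlog : 1 - y / x ≤ Real.log x - Real.log y := by
    have := Real.one_sub_inv_le_log_of_pos (div_pos hx hy)
    rwa [inv_div, Real.log_div hx.ne' hy.ne'] at this
  have hmono : Real.log y ≤ Real.log x := Real.log_le_log hy h
  rw [abs_of_nonneg (sub_nonneg.2 h), abs_of_nonneg (sub_nonneg.2 hmono)]
  calc x - y = x * (1 - y / x) := by field_simp
    _ ≤ x * (Real.log x - Real.log y) := by gcongr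
    _ ≤ L * (Real.log x - Real.log y) := by
      gcongr

lemma summable_exp_neg_abs_div_four : Summable fun k : ℤ ↦ Real.exp (-|(k : ℝ)| / 4) := by
  have h : Summable fun n : ℕ ↦ Real.exp (-(n : ℝ) / 4) := by
    have := Real.summable_exp_nat_mul_iff.2 (show (-1 / 4 : ℝ) < 0 by norm_num)
    refine this.congr fun n ↦ ?_
    congr 1
    ring
  refine Summable.of_nat_of_neg ?_ ?_ <;> simpa using h

lemma integrable_cexp_I_mul_mul_gaussian {b : ℂ} (hb : 0 < b.re) (s : ℂ) :
    Integrable fun t : ℝ ↦ cexp (I * s * t) * cexp (-b * t ^ 2) := by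
  refine (integrable_cexp_quadratic hb (I * s) 0).congr ?_
  refine Filter.Eventually.of_forall fun t ↦ ?_
  simp only [← Complex.exp_add]
  congr 1
  ring

/-- Bound for the Fourier transform of the Gaussian of width `L`, at frequencies `s` with
`|k| ≤ L * |s|`. -/
lemma norm_integral_cexp_mul_gaussian_le {L s : ℝ} (hL : 0 < L) {k : ℤ}
    (hk : |(k : ℝ)| ≤ L * |s|) :
    ‖∫ t : ℝ, cexp (I * s * t) * cexp (-((L⁻¹ ^ 2 : ℝ) : ℂ) * t ^ 2)‖ ≤
      2 * L * Real.exp (-|(k : ℝ)| / 4) := by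
  have hb : 0 < L⁻¹ ^ 2 := by positivity
  rw [fourierIntegral_gaussian (by rwa [ofReal_re]), norm_mul]
  gcongr
  · rw [← ofReal_div, norm_cpow_eq_rpow_re_of_pos (by positivity)]
    have : (1 / 2 : ℂ).re = 1 / 2 := by norm_num
    rw [this, ← Real.sqrt_eq_rpow, Real.sqrt_le_left (by positivity)]
    have : Real.pi / L⁻¹ ^ 2 = Real.pi * L ^ 2 := by field_simp
    rw [this]
    nlinarith [Real.pi_le_four, sq_nonneg L]
  · have hsq : |(k : ℝ)| ≤ (L * s) ^ 2 := by
      have h1 : |(k : ℝ)| ≤ |(k : ℝ)| ^ 2 := by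
        exact_mod_cast Int.le_self_sq |k|
      calc |(k : ℝ)| ≤ |(k : ℝ)| ^ 2 := h1
        _ ≤ (L * |s|) ^ 2 := by gcongr
        _ = (L * s) ^ 2 := by rw [mul_pow, sq_abs, mul_pow]
    have harg : (-(s : ℂ) ^ 2 / (4 * ((L⁻¹ ^ 2 : ℝ) : ℂ))) = ((-(L * s) ^ 2 / 4 : ℝ) : ℂ) := by
      push_cast
      have : (L : ℂ) ≠ 0 := ofReal_ne_zero.2 hL.ne'
      field_simp
    rw [harg, norm_exp, ofReal_re]
    gcongr

/-- Schur's test for a symmetric kernel with nonnegative entries. -/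
lemma sum_sum_mul_le_of_symmetric {ι : Type*} (s : Finset ι) (x : ι → ℝ) (K : ι → ι → ℝ) {B : ℝ}
    (hK : ∀ m n, 0 ≤ K m n) (hsymm : ∀ m n, K m n = K n m)
    (hB : ∀ m ∈ s, ∑ n ∈ s, K m n ≤ B) :
    ∑ m ∈ s, ∑ n ∈ s, x m * x n * K m n ≤ B * ∑ n ∈ s, x n ^ 2 := by
  have hdiag : ∑ m ∈ s, ∑ n ∈ s, x m ^ 2 * K m n ≤ B * ∑ n ∈ s, x n ^ 2 := by
    rw [Finset.mul_sum]
    refine Finset.sum_le_sum fun m hm ↦ ?_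
    rw [← Finset.mul_sum, mul_comm]
    exact mul_le_mul_of_nonneg_right (hB m hm) (sq_nonneg _)
  have hswap : ∑ m ∈ s, ∑ n ∈ s, x n ^ 2 * K m n = ∑ m ∈ s, ∑ n ∈ s, x m ^ 2 * K m n := by
    rw [Finset.sum_comm]
    simp only [hsymm]
  have hle : ∑ m ∈ s, ∑ n ∈ s, x m * x n * K m n ≤
      ∑ m ∈ s, ∑ n ∈ s, (x m ^ 2 * K m n + x n ^ 2 * K m n) / 2 := by
    refine Finset.sum_le_sum fun m _ ↦ Finset.sum_le_sum fun n _ ↦ ?_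
    nlinarith [mul_nonneg (hK m n) (sq_nonneg (x m - x n))]
  simp only [← Finset.sum_div, Finset.sum_add_distrib, hswap] at hle
  linarith

/-- The Gaussian-weighted mean square of a Dirichlet polynomial of length at most `L`, with
Gaussian of width `L`. -/
lemma integral_norm_sq_mul_gaussian_le (N : ℕ) (a : ℕ → ℂ) {L : ℝ} (hL : 0 < L) (hN : N ≤ L) :
    Integrable (fun t : ℝ ↦
      ‖∑ n ∈ Finset.Icc 1 N, a n * cexp (I * t * Real.log n)‖ ^ 2 *
        Real.exp (-(L⁻¹ ^ 2) * t ^ 2)) ∧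
    ∫ t : ℝ, ‖∑ n ∈ Finset.Icc 1 N, a n * cexp (I * t * Real.log n)‖ ^ 2 *
        Real.exp (-(L⁻¹ ^ 2) * t ^ 2) ≤
      2 * L * (∑' k : ℤ, Real.exp (-|(k : ℝ)| / 4)) * ∑ n ∈ Finset.Icc 1 N, ‖a n‖ ^ 2 := by
  have hb : 0 < ((L⁻¹ ^ 2 : ℝ) : ℂ).re := by
    rw [ofReal_re]
    positivity
  have hexpand (t : ℝ) : ((‖∑ n ∈ Finset.Icc 1 N, a n * cexp (I * t * Real.log n)‖ ^ 2 *
        Real.exp (-(L⁻¹ ^ 2) * t ^ 2) : ℝ) : ℂ) =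
      ∑ m ∈ Finset.Icc 1 N, ∑ n ∈ Finset.Icc 1 N, a m * (starRingEnd ℂ) (a n) *
        (cexp (I * ((Real.log m - Real.log n : ℝ) : ℂ) * t) *
          cexp (-((L⁻¹ ^ 2 : ℝ) : ℂ) * t ^ 2)) := by
    rw [ofReal_mul, ofReal_pow, ← mul_conj', map_sum, Finset.sum_mul_sum, Finset.sum_mul]
    refine Finset.sum_congr rfl fun m _ ↦ ?_
    rw [Finset.sum_mul]
    refine Finset.sum_congr rfl fun n _ ↦ ?_
    have hexp : cexp (I * ((Real.log m - Real.log n : ℝ) : ℂ) * t) =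
        cexp (I * t * Real.log m) * (starRingEnd ℂ) (cexp (I * t * Real.log n)) := by
      rw [← exp_conj, ← Complex.exp_add]
      congr 1
      simp only [map_mul, conj_I, conj_ofReal, ofReal_sub]
      ring
    rw [hexp, map_mul, ofReal_exp]
    push_cast
    ring
  have hterm (m n : ℕ) := (integrable_cexp_I_mul_mul_gaussian hb
    ((Real.log m - Real.log n : ℝ) : ℂ)).const_mul (a m * (starRingEnd ℂ) (a n))
  have h_integrable := integrable_finsetSum (Finset.Icc 1 N) fun m _ ↦
    integrable_finsetSum (Finset.Icc 1 N) fun n _ ↦ hterm m n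
  simp only [← hexpand] at h_integrable
  refine ⟨h_integrable.re, ?_⟩
  refine (le_abs_self _).trans ?_
  rw [← Real.norm_eq_abs, ← norm_real, ← integral_complex_ofReal]
  simp only [hexpand]
  rw [integral_finsetSum _ fun m _ ↦ integrable_finsetSum _ fun n _ ↦ hterm m n]
  simp only [integral_finsetSum _ fun n _ ↦ hterm _ n, integral_const_mul]
  calc _ ≤ ∑ m ∈ Finset.Icc 1 N, ∑ n ∈ Finset.Icc 1 N,
        ‖a m‖ * ‖a n‖ * (2 * L * Real.exp (-|((m - n : ℤ) : ℝ)| / 4)) := by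
        refine norm_sum_le_of_le _ fun m hm ↦ norm_sum_le_of_le _ fun n hn ↦ ?_
        rw [norm_mul, norm_mul, RCLike.norm_conj]
        gcongr
        rw [Finset.mem_Icc] at hm hn
        refine norm_integral_cexp_mul_gaussian_le hL ?_
        push_cast
        refine abs_sub_le_mul_abs_log_sub_log (by exact_mod_cast hm.1) (by exact_mod_cast hn.1)
          (le_trans ?_ hN) (le_trans ?_ hN)
        · exact_mod_cast hm.2
        · exact_mod_cast hn.2
    _ ≤ _ := by
        refine sum_sum_mul_le_of_symmetric _ _ _ (fun m n ↦ by positivity) (fun m n ↦ ?_)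
          fun m _ ↦ ?_
        · push_cast
          rw [abs_sub_comm]
        · rw [← Finset.mul_sum]
          gcongr
          have hinj : Set.InjOn (fun n : ℕ ↦ (m - n : ℤ)) (Finset.Icc 1 N) := by
            intro i _ j _ hij
            simpa using hij
          rw [← Finset.sum_image (f := fun k : ℤ ↦ Real.exp (-|(k : ℝ)| / 4)) hinj]
          exact summable_exp_neg_abs_div_four.sum_le_tsum _ fun _ _ ↦ by positivity

/-- Classical mean value theorem for Dirichlet polynomials:
there is an absolute constant `C > 0` such that for all `T > 0`, `N ≥ 1` and
complex coefficients `a_1, …, a_N`,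
`∫_0^T |∑_{n=1}^N a_n n^{it}|² dt ≤ C (T + N) ∑_{n=1}^N |a_n|²`,
where `n^{it} = exp(i t log n)`. -/
theorem dirichlet_polynomial_mean_value :
    ∃ C : ℝ, 0 < C ∧ ∀ (T : ℝ), 0 < T → ∀ (N : ℕ), 1 ≤ N → ∀ a : ℕ → ℂ,
      (∫ t in Set.Ioc (0 : ℝ) T,
          ‖∑ n ∈ Finset.Icc 1 N, a n * Complex.exp (Complex.I * t * Real.log n)‖ ^ 2)
        ≤ C * (T + N) * ∑ n ∈ Finset.Icc 1 N, ‖a n‖ ^ 2 := by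
  have hS : 0 < ∑' k : ℤ, Real.exp (-|(k : ℝ)| / 4) :=
    summable_exp_neg_abs_div_four.tsum_pos (fun _ ↦ by positivity) 0 (by positivity)
  refine ⟨Real.exp 1 * (2 * ∑' k : ℤ, Real.exp (-|(k : ℝ)| / 4)), by positivity,
    fun T hT N _ a ↦ ?_⟩
  have hL : 0 < T + N := by positivity
  obtain ⟨h_integrable, hle⟩ := integral_norm_sq_mul_gaussian_le N a hL (by linarith)
  have h_integrable_exp := h_integrable.const_mul (Real.exp 1)
  calc _ ≤ ∫ t in Set.Ioc (0 : ℝ) T, Real.exp 1 *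
          (‖∑ n ∈ Finset.Icc 1 N, a n * cexp (I * t * Real.log n)‖ ^ 2 *
            Real.exp (-((T + N)⁻¹ ^ 2) * t ^ 2)) := by
        refine setIntegral_mono_on (Continuous.integrableOn_Ioc (by fun_prop))
          h_integrable_exp.integrableOn measurableSet_Ioc fun t ht ↦ ?_
        rw [mul_left_comm, ← Real.exp_add]
        refine le_mul_of_one_le_right (by positivity) (Real.one_le_exp ?_)
        have h1 : (T + N)⁻¹ * t ≤ 1 := by
          rw [inv_mul_le_one₀ hL]
          linarith [ht.2, Nat.cast_nonneg (α := ℝ) N]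
        have h0 : 0 ≤ (T + N)⁻¹ * t := mul_nonneg (by positivity) ht.1.le
        nlinarith
    _ ≤ ∫ t : ℝ, Real.exp 1 *
          (‖∑ n ∈ Finset.Icc 1 N, a n * cexp (I * t * Real.log n)‖ ^ 2 *
            Real.exp (-((T + N)⁻¹ ^ 2) * t ^ 2)) :=
        setIntegral_le_integral h_integrable_exp (Filter.Eventually.of_forall fun t ↦ by positivity)
    _ ≤ Real.exp 1 * (2 * (T + N) * (∑' k : ℤ, Real.exp (-|(k : ℝ)| / 4)) *
          ∑ n ∈ Finset.Icc 1 N, ‖a n‖ ^ 2) := by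
        rw [integral_const_mul]
        gcongr
    _ = _ := by ring
end

section
/- For every real A > 0 there exist a natural number J and a constant C > 0 such that the following holds. Let X, Y, Z > 0 with Y/X ≥ 1. Let w : ℝ → ℂ be a smooth function whose support is contained in [Z, 2Z] and which satisfies |w^{(j)}(ξ)| ≤ (X/Z)^j for all ξ ∈ ℝ and all 0 ≤ j ≤ J. Let h : ℝ → ℝ be smooth and satisfy |h^{(j)}(ξ)| ≤ Y/Z^j for all ξ in the support of w and all 1 ≤ j ≤ J, and moreover |h′(ξ)| ≥ Y/Z for all ξ in the support of w. Then |∫_ℝ w(ξ) e^{i h(ξ)} dξ| ≤ C · Z · (Y/X)^{−A}. -/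
open MeasureTheory Complex

/-- Derivatives of a quotient are controlled by those of numerator `q * u` and denominator `q`,
with constants depending only on the order. -/
lemma exists_norm_iteratedDeriv_le_of_mul (N : ℕ) :
    ∃ K : ℝ, 0 ≤ K ∧ ∀ (q u : ℝ → ℂ) (x L R M : ℝ), ContDiff ℝ (⊤ : ℕ∞) q →
      ContDiff ℝ (⊤ : ℕ∞) u → 0 < L → 0 ≤ R → 0 ≤ M → L ≤ ‖q x‖ →
      (∀ j ≤ N, ‖iteratedDeriv j q x‖ ≤ L * R ^ j) →
      (∀ j ≤ N, ‖iteratedDeriv j (q * u) x‖ ≤ M * R ^ j) →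
      ∀ j ≤ N, ‖iteratedDeriv j u x‖ ≤ K * (M / L) * R ^ j := by
  induction N with
  | zero =>
    refine ⟨1, zero_le_one, fun q u x L R M _ _ hL _ _ hqx _ hqu j hj ↦ ?_⟩
    obtain rfl : j = 0 := by omega
    have h0 := hqu 0 le_rfl
    simp only [iteratedDeriv_zero, Pi.mul_apply, norm_mul, pow_zero, mul_one, one_mul] at h0 ⊢
    rw [le_div_iff₀ hL]
    nlinarith [norm_nonneg (u x)]
  | succ N ih =>
    obtain ⟨K, hK, ih⟩ := ih
    set B : ℝ := ∑ k ∈ Finset.range (N + 1), ((N + 1).choose (k + 1) : ℝ) * K with hB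
    have hB0 : 0 ≤ B := Finset.sum_nonneg fun k _ ↦ by positivity
    refine ⟨K + 1 + B, by positivity, fun q u x L R M hq hu hL hR hM hqx hqj hqu j hj ↦ ?_⟩
    have low := ih q u x L R M hq hu hL hR hM hqx
      (fun j hj ↦ hqj j (by omega)) (fun j hj ↦ hqu j (by omega))
    rcases Nat.lt_or_ge N j with hNj | hjN
    · obtain rfl : j = N + 1 := by omega
      have leibniz := iteratedDeriv_mul (n := N + 1) (x := x)
        (hq.contDiffAt.of_le (by exact_mod_cast le_top))
        (hu.contDiffAt.of_le (by exact_mod_cast le_top))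
      rw [Finset.sum_range_succ'] at leibniz
      simp only [Nat.choose_zero_right, Nat.cast_one, one_mul, iteratedDeriv_zero,
        Nat.sub_zero] at leibniz
      have hsum : ‖∑ k ∈ Finset.range (N + 1), ((N + 1).choose (k + 1) : ℂ) *
          iteratedDeriv (k + 1) q x * iteratedDeriv (N + 1 - (k + 1)) u x‖ ≤
          B * M * R ^ (N + 1) := by
        rw [hB, Finset.sum_mul, Finset.sum_mul]
        refine norm_sum_le_of_le _ fun k hk ↦ ?_
        have hk' : k ≤ N := by simpa [Nat.lt_succ_iff] using hk
        rw [norm_mul, norm_mul, Complex.norm_natCast]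
        calc _ ≤ ((N + 1).choose (k + 1) : ℝ) * (L * R ^ (k + 1)) *
              (K * (M / L) * R ^ (N + 1 - (k + 1))) := by
              gcongr
              · exact hqj _ (by omega)
              · exact low _ (by omega)
          _ = ((N + 1).choose (k + 1) : ℝ) * K * M * (R ^ (k + 1) * R ^ (N + 1 - (k + 1))) := by
              field_simp
          _ = _ := by rw [← pow_add]; congr 2; omega
      have key : q x * iteratedDeriv (N + 1) u x = iteratedDeriv (N + 1) (q * u) x -
          ∑ k ∈ Finset.range (N + 1), ((N + 1).choose (k + 1) : ℂ) *
          iteratedDeriv (k + 1) q x * iteratedDeriv (N + 1 - (k + 1)) u x := by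
        rw [leibniz]; ring
      have hle : L * ‖iteratedDeriv (N + 1) u x‖ ≤ (1 + B) * M * R ^ (N + 1) := by
        calc _ ≤ ‖q x‖ * ‖iteratedDeriv (N + 1) u x‖ := by gcongr
          _ = ‖q x * iteratedDeriv (N + 1) u x‖ := (norm_mul _ _).symm
          _ ≤ M * R ^ (N + 1) + B * M * R ^ (N + 1) := by
            rw [key]; exact (norm_sub_le _ _).trans (add_le_add (hqu _ le_rfl) hsum)
          _ = _ := by ring
      calc ‖iteratedDeriv (N + 1) u x‖ ≤ (1 + B) * M * R ^ (N + 1) / L := by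
            rwa [le_div_iff₀' hL]
        _ = (0 + 1 + B) * (M / L) * R ^ (N + 1) := by ring
        _ ≤ _ := by gcongr
    · refine (low j hjN).trans ?_
      gcongr
      linarith

/-- A quotient is smooth when the denominator does not vanish on the topological support of the
numerator. -/
lemma ContDiff.div_of_ne_zero_on_tsupport {w q : ℝ → ℂ} {n : WithTop ℕ∞} (hw : ContDiff ℝ n w)
    (hq : ContDiff ℝ n q) (hne : ∀ x ∈ tsupport w, q x ≠ 0) :
    ContDiff ℝ n (fun x ↦ w x / q x) := by
  rw [contDiff_iff_contDiffAt]
  intro x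
  by_cases hx : x ∈ tsupport w
  · simpa only [div_eq_mul_inv, Pi.inv_apply] using hw.contDiffAt.mul (hq.contDiffAt.inv (hne x hx))
  · refine (contDiffAt_const (c := (0 : ℂ))).congr_of_eventuallyEq ?_
    filter_upwards [notMem_tsupport_iff_eventuallyEq.mp hx] with y hy
    simp [hy]

/-- Integration by parts against a function `E` with `E' = q E`. -/
lemma integral_mul_eq_neg_integral_deriv_div_mul {w q E : ℝ → ℂ} (hw : ContDiff ℝ (⊤ : ℕ∞) w)
    (hq : ContDiff ℝ (⊤ : ℕ∞) q) (hcs : HasCompactSupport w)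
    (hne : ∀ x ∈ tsupport w, q x ≠ 0) (hE : ∀ x, HasDerivAt E (q x * E x) x) :
    ∫ x, w x * E x = -∫ x, deriv (fun y ↦ w y / q y) x * E x := by
  set u : ℝ → ℂ := fun y ↦ w y / q y with hu
  have hus : ContDiff ℝ (⊤ : ℕ∞) u := hw.div_of_ne_zero_on_tsupport hq hne
  have hucs : HasCompactSupport u :=
    hcs.mono fun x hx ↦ by contrapose! hx; simp [hu, Function.notMem_support.mp hx]
  have hEc : Continuous E := continuous_iff_continuousAt.mpr fun x ↦ (hE x).continuousAt
  have hdu : Continuous (deriv u) := hus.continuous_deriv (by exact_mod_cast le_top)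
  have hud : Differentiable ℝ u := hus.differentiable (by simp)
  have parts := integral_mul_deriv_eq_deriv_mul_of_integrable (u := u) (v := E)
    (fun x _ ↦ (hud x).hasDerivAt) (fun x _ ↦ hE x)
    ((hus.continuous.mul (hq.continuous.mul hEc)).integrable_of_hasCompactSupport hucs.mul_right)
    ((hdu.mul hEc).integrable_of_hasCompactSupport hucs.deriv.mul_right)
    ((hus.continuous.mul hEc).integrable_of_hasCompactSupport hucs.mul_right)
  rw [← parts]
  congr 1 with x
  by_cases hx : x ∈ tsupport w
  · have := hne x hx
    simp only [hu]
    field_simp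
  · simp [hu, image_eq_zero_of_notMem_tsupport hx]

/-- Repeated integration by parts: each step gains a factor `R / L`. -/
lemma exists_norm_integral_le_of_phase_deriv (N : ℕ) :
    ∃ C : ℝ, 0 < C ∧ ∀ (w q E : ℝ → ℂ) (S : Set ℝ) (a b L R M : ℝ), IsClosed S →
      ContDiff ℝ (⊤ : ℕ∞) w → ContDiff ℝ (⊤ : ℕ∞) q → a ≤ b → 0 < L → 0 ≤ R → 0 ≤ M →
      Function.support w ⊆ S → S ⊆ Set.Icc a b →
      (∀ x, HasDerivAt E (q x * E x) x) → (∀ x, ‖E x‖ ≤ 1) →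
      (∀ x ∈ S, L ≤ ‖q x‖) →
      (∀ j ≤ N, ∀ x ∈ S, ‖iteratedDeriv j q x‖ ≤ L * R ^ j) →
      (∀ j ≤ N, ∀ x, ‖iteratedDeriv j w x‖ ≤ M * R ^ j) →
      ‖∫ x, w x * E x‖ ≤ C * (b - a) * M * (R / L) ^ N := by
  induction N with
  | zero =>
    refine ⟨1, one_pos, fun w q E S a b L R M _ _ _ hab _ _ hM hwS hS _ hE _ _ hw ↦ ?_⟩
    rw [← setIntegral_eq_integral_of_forall_compl_eq_zero (s := Set.Icc a b) fun x hx ↦ by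
      rw [Function.notMem_support.mp fun h ↦ hx (hS (hwS h)), zero_mul]]
    refine (norm_setIntegral_le_of_norm_le_const (C := M) (by simp) fun x _ ↦ ?_).trans
      (le_of_eq ?_)
    · have := hw 0 le_rfl x
      simp only [iteratedDeriv_zero, pow_zero, mul_one] at this
      rw [norm_mul]
      nlinarith [hE x, norm_nonneg (w x), norm_nonneg (E x)]
    · simp [Real.volume_real_Icc_of_le hab]; ring
  | succ N ih =>
    obtain ⟨C, hC, ih⟩ := ih
    obtain ⟨K, hK, quot⟩ := exists_norm_iteratedDeriv_le_of_mul (N + 1)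
    refine ⟨C * (K + 1), by positivity,
      fun w q E S a b L R M hSc hws hqs hab hL hR hM hwS hS hE hE1 hLq hq hw ↦ ?_⟩
    have htS : tsupport w ⊆ S := closure_minimal hwS hSc
    have hne : ∀ x ∈ tsupport w, q x ≠ 0 := fun x hx ↦
      norm_pos_iff.mp (hL.trans_le (hLq x (htS hx)))
    have hcs : HasCompactSupport w :=
      isCompact_Icc.of_isClosed_subset (isClosed_tsupport w) (htS.trans hS)
    rw [integral_mul_eq_neg_integral_deriv_div_mul hws hqs hcs hne hE, norm_neg]
    set u : ℝ → ℂ := fun y ↦ w y / q y with hu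
    have hus : ContDiff ℝ (⊤ : ℕ∞) u := hws.div_of_ne_zero_on_tsupport hqs hne
    have huS : tsupport u ⊆ S := closure_minimal (fun x hx ↦ hwS <| by
      contrapose! hx; simp [hu, Function.notMem_support.mp hx]) hSc
    have hqu : q * u = w := by
      ext x
      by_cases hx : x ∈ tsupport w
      · have := hne x hx
        simp only [hu, Pi.mul_apply]
        field_simp
      · simp [hu, image_eq_zero_of_notMem_tsupport hx]
    have hubound : ∀ j ≤ N + 1, ∀ x, ‖iteratedDeriv j u x‖ ≤ K * (M / L) * R ^ j := by
      intro j hj x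
      by_cases hx : x ∈ S
      · exact quot q u x L R M hqs hus hL hR hM (hLq x hx) (fun j hj ↦ hq j hj x hx)
          (fun j hj ↦ by rw [hqu]; exact hw j hj x) j hj
      · have h0 := (notMem_tsupport_iff_eventuallyEq.mp fun h ↦ hx (huS h)).iteratedDeriv_eq j
        rw [h0]
        simp only [Pi.zero_def, iteratedDeriv_const]
        split_ifs <;> simp <;> positivity
    have := ih (deriv u) q E S a b L R (K * (M / L) * R) hSc
      (contDiff_infty_iff_deriv.mp hus).2 hqs hab hL hR (by positivity)
      (support_deriv_subset.trans huS) hS hE hE1 hLq (fun j hj ↦ hq j (by omega))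
      (fun j hj x ↦ by
        rw [← iteratedDeriv_succ', mul_assoc _ R, ← pow_succ']
        exact hubound _ (by omega) x)
    calc _ ≤ C * (b - a) * (K * (M / L) * R) * (R / L) ^ N := this
      _ = C * K * (b - a) * M * (R / L) ^ (N + 1) := by ring
      _ ≤ _ := by
        have : 0 ≤ b - a := sub_nonneg.mpr hab
        gcongr
        linarith

/-- A function supported in an interval of length `b - a` is bounded by `(b - a) ^ k` times the
supremum of its `k`-th derivative. -/
lemma norm_le_of_norm_iteratedDeriv_le {a b B : ℝ} (hab : a ≤ b) (k : ℕ) :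
    ∀ w : ℝ → ℂ, ContDiff ℝ (⊤ : ℕ∞) w → tsupport w ⊆ Set.Icc a b →
      (∀ x, ‖iteratedDeriv k w x‖ ≤ B) → ∀ x, ‖w x‖ ≤ (b - a) ^ k * B := by
  induction k with
  | zero => intro w _ _ h x; simpa using h x
  | succ k ih =>
    intro w hw hsupp hB x
    have hd : ∀ x, ‖deriv w x‖ ≤ (b - a) ^ k * B :=
      ih (deriv w) (contDiff_infty_iff_deriv.mp hw).2 (tsupport_deriv_subset.trans hsupp)
        fun x ↦ by rw [← iteratedDeriv_succ']; exact hB x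
    have hba : 0 ≤ b - a := sub_nonneg.mpr hab
    have hnn : 0 ≤ (b - a) ^ k * B := (norm_nonneg _).trans (hd x)
    by_cases hx : x ∈ Set.Icc a b
    · have hwa : w a = 0 := by
        have hcl : Set.EqOn w 0 (closure (Set.Iio a)) :=
          Set.EqOn.closure (fun y hy ↦ image_eq_zero_of_notMem_tsupport fun h ↦
            absurd (hsupp h).1 (not_le.mpr hy)) hw.continuous continuous_const
        exact hcl (by simp)
      have := Convex.norm_image_sub_le_of_norm_deriv_le (𝕜 := ℝ) (f := w) (s := Set.univ)
        (fun x _ ↦ hw.differentiable (by simp) x) (fun x _ ↦ hd x) convex_univ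
        (Set.mem_univ a) (Set.mem_univ x)
      rw [hwa, sub_zero, Real.norm_of_nonneg (sub_nonneg.mpr hx.1)] at this
      calc _ ≤ _ := this
        _ ≤ (b - a) ^ k * B * (b - a) := by gcongr; exact hx.2
        _ = _ := by ring
    · rw [image_eq_zero_of_notMem_tsupport fun h ↦ hx (hsupp h), norm_zero, pow_succ']
      rw [mul_assoc]; positivity

lemma tsupport_iteratedDeriv_subset (w : ℝ → ℂ) (j : ℕ) :
    tsupport (iteratedDeriv j w) ⊆ tsupport w := by
  induction j with
  | zero => simp
  | succ j ih => rw [iteratedDeriv_succ]; exact tsupport_deriv_subset.trans ih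

/-- If the first `N` derivatives of a function supported in an interval of length `Z` are bounded
by powers of `X / Z`, then for `X < 1` the bound on the `N`-th also improves the lower ones. -/
lemma norm_iteratedDeriv_le_min_pow_mul_max {X Z a : ℝ} (hX : 0 < X) (hZ : 0 < Z) {N : ℕ}
    {w : ℝ → ℂ} (hw : ContDiff ℝ (⊤ : ℕ∞) w) (hsupp : tsupport w ⊆ Set.Icc a (a + Z))
    (hbound : ∀ j ≤ N, ∀ x, ‖iteratedDeriv j w x‖ ≤ (X / Z) ^ j) {j : ℕ} (hj : j ≤ N) (x : ℝ) :
    ‖iteratedDeriv j w x‖ ≤ min X 1 ^ N * (max X 1 / Z) ^ j := by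
  rcases le_total 1 X with h1 | h1
  · simpa [h1] using hbound j hj x
  · have hj' : ContDiff ℝ (⊤ : ℕ∞) (iteratedDeriv j w) := by
      rw [iteratedDeriv_eq_iterate]; exact hw.iterate_deriv j
    have := norm_le_of_norm_iteratedDeriv_le (a := a) (b := a + Z) (B := (X / Z) ^ N)
      (by linarith) (N - j) _ hj' ((tsupport_iteratedDeriv_subset w j).trans hsupp)
      (fun x ↦ by
        have : iteratedDeriv (N - j) (iteratedDeriv j w) = iteratedDeriv N w := by
          simp only [iteratedDeriv_eq_iterate, ← Function.iterate_add_apply]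
          congr 2; omega
        rw [this]; exact hbound N le_rfl x) x
    refine this.trans (le_of_eq ?_)
    obtain ⟨m, rfl⟩ := Nat.exists_eq_add_of_le hj
    simp only [min_eq_left h1, max_eq_right h1, add_sub_cancel_left, Nat.add_sub_cancel_left]
    rw [div_pow, div_pow, one_pow, pow_add Z]
    field_simp

/-- Non-stationary phase estimate: for every `A > 0` there are `J ∈ ℕ` and `C > 0` such that
for all `X, Y, Z > 0` with `Y/X ≥ 1`, every smooth `w : ℝ → ℂ` supported in `[Z, 2Z]` with
`|w^{(j)}(ξ)| ≤ (X/Z)^j` for `0 ≤ j ≤ J`, and every smooth `h : ℝ → ℝ` with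
`|h^{(j)}(ξ)| ≤ Y/Z^j` on the support of `w` for `1 ≤ j ≤ J` and `|h'(ξ)| ≥ Y/Z` on the
support of `w`, one has `|∫ w(ξ) e^{i h(ξ)} dξ| ≤ C Z (Y/X)^{-A}`. -/
theorem nonstationary_phase (A : ℝ) (hA : 0 < A) :
    ∃ (J : ℕ) (C : ℝ), 0 < C ∧
      ∀ (X Y Z : ℝ), 0 < X → 0 < Y → 0 < Z → 1 ≤ Y / X →
      ∀ (w : ℝ → ℂ), ContDiff ℝ (⊤ : ℕ∞) w →
        Function.support w ⊆ Set.Icc Z (2 * Z) →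
        (∀ j : ℕ, j ≤ J → ∀ ξ : ℝ, ‖iteratedDeriv j w ξ‖ ≤ (X / Z) ^ j) →
      ∀ (h : ℝ → ℝ), ContDiff ℝ (⊤ : ℕ∞) h →
        (∀ j : ℕ, 1 ≤ j → j ≤ J → ∀ ξ ∈ Function.support w, |iteratedDeriv j h ξ| ≤ Y / Z ^ j) →
        (∀ ξ ∈ Function.support w, Y / Z ≤ |deriv h ξ|) →
      ‖∫ ξ : ℝ, w ξ * Complex.exp (Complex.I * (h ξ : ℂ))‖ ≤ C * Z * (Y / X) ^ (-A) := by
  obtain ⟨N, hN⟩ := exists_nat_ge A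
  obtain ⟨C, hC, main⟩ := exists_norm_integral_le_of_phase_deriv N
  refine ⟨N + 1, C, hC, fun X Y Z hX hY hZ hYX w hw hsupp hwb h hh hhb hhl ↦ ?_⟩
  have htsupp : tsupport w ⊆ Set.Icc Z (2 * Z) := closure_minimal hsupp isClosed_Icc
  have hdh : ContDiff ℝ (⊤ : ℕ∞) (deriv h) := (contDiff_infty_iff_deriv.mp hh).2
  set q : ℝ → ℂ := fun x ↦ deriv h x • Complex.I with hq
  have hqs : ContDiff ℝ (⊤ : ℕ∞) q := hdh.smul contDiff_const
  have hqj (j : ℕ) (x : ℝ) : ‖iteratedDeriv j q x‖ = |iteratedDeriv (j + 1) h x| := by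
    rw [hq, iteratedDeriv_smul_const (hdh.contDiffAt.of_le (by exact_mod_cast le_top)),
      ← iteratedDeriv_succ', norm_smul, Complex.norm_I, mul_one, Real.norm_eq_abs]
  have hE (x : ℝ) : HasDerivAt (fun ξ ↦ Complex.exp (Complex.I * (h ξ : ℂ)))
      (q x * Complex.exp (Complex.I * (h x : ℂ))) x := by
    have hd := (((hh.differentiable (by simp) x).hasDerivAt.ofReal_comp).const_mul Complex.I).cexp
    convert hd using 1
    simp only [hq, Complex.real_smul]
    ring
  have hbound := main w q _ (tsupport w) Z (2 * Z) (Y / Z) (max X 1 / Z) (min X 1 ^ N)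
    (isClosed_tsupport w) hw hqs (by linarith) (by positivity) (by positivity) (by positivity)
    subset_closure htsupp hE
    (fun x ↦ by rw [mul_comm, Complex.norm_exp_ofReal_mul_I])
    (fun x hx ↦ by
      have hcl : IsClosed {y | Y / Z ≤ |deriv h y|} :=
        isClosed_le continuous_const hdh.continuous.abs
      have : Y / Z ≤ |deriv h x| := closure_minimal (fun y hy ↦ hhl y hy) hcl hx
      simpa [hq] using this)
    (fun j hj x hx ↦ by
      have hcl : IsClosed {y | |iteratedDeriv (j + 1) h y| ≤ Y / Z ^ (j + 1)} :=
        isClosed_le (hh.continuous_iteratedDeriv _ (by exact_mod_cast le_top)).abs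
          continuous_const
      have hx' : |iteratedDeriv (j + 1) h x| ≤ Y / Z ^ (j + 1) :=
        closure_minimal (fun y hy ↦ hhb (j + 1) (by omega) (by omega) y hy) hcl hx
      rw [hqj]
      calc _ ≤ _ := hx'
        _ = Y / Z * (1 / Z) ^ j := by rw [div_pow, one_pow, pow_succ]; field_simp
        _ ≤ _ := by gcongr; exact le_max_right _ _)
    (fun j hj x ↦ norm_iteratedDeriv_le_min_pow_mul_max (a := Z) hX hZ hw
      (by rwa [← two_mul]) (fun j hj ↦ hwb j (by omega)) hj x)
  calc _ ≤ _ := hbound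
    _ = C * Z * ((min X 1 * max X 1) / Y) ^ N := by
      rw [div_div_div_cancel_right₀ hZ.ne', div_pow, div_pow, mul_pow]
      ring
    _ = C * Z * (Y / X) ^ (-(N : ℝ)) := by
      rw [min_mul_max, mul_one, Real.rpow_neg (by positivity), Real.rpow_natCast, ← inv_pow,
        inv_div]
    _ ≤ _ := by gcongr
end

section
/- For every real A > 0 there exist a natural number J and a constant C > 0 such that the following holds. Let X, Y, Z, R > 0 with Y/X² ≥ R ≥ 1. Let w : ℝ → ℂ be a smooth function whose support is contained in [Z, 2Z] and which satisfies |w^{(j)}(ξ)| ≤ (X/Z)^j for all ξ ∈ ℝ and all 0 ≤ j ≤ J. Let h : ℝ → ℝ be smooth with |h^{(j)}(ξ)| ≤ Y/Z^j for all ξ ∈ [Z, 2Z] and all 0 ≤ j ≤ J, with h″(ξ) ≥ Y/Z² for all ξ ∈ [Z, 2Z], and suppose there exists ξ₀ ∈ [Z, 2Z] with h′(ξ₀) = 0. Then there exists a complex number κ with |κ| ≤ C such that |∫_ℝ w(ξ) e^{i h(ξ)} dξ − κ · e^{i h(ξ₀)} / √(h″(ξ₀))| ≤ C · Z · R^{−A}.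 -/
open MeasureTheory Complex

/-- Away from the stationary point, two integrations by parts bound an oscillatory integral by
the reciprocal of the phase derivative at the left endpoint. -/
theorem norm_integral_exp_le_of_le_deriv {a b m l : ℝ} (hab : a ≤ b) (hl : 0 < l)
    (hml : m ≤ l) (hm : 0 ≤ m) {w w₁ w₂ : ℝ → ℂ} {h g g₁ : ℝ → ℝ}
    (hw : ∀ x, HasDerivAt w (w₁ x) x) (hw₁ : ∀ x, HasDerivAt w₁ (w₂ x) x)
    (hh : ∀ x, HasDerivAt h (g x) x) (hg : ∀ x, HasDerivAt g (g₁ x) x)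
    (bw : ∀ x ∈ Set.Icc a b, ‖w x‖ ≤ 1) (bw₁ : ∀ x ∈ Set.Icc a b, ‖w₁ x‖ ≤ m)
    (bw₂ : ∀ x ∈ Set.Icc a b, ‖w₂ x‖ ≤ m ^ 2)
    (bg : ∀ x ∈ Set.Icc a b, l ≤ g x) (bg₁ : ∀ x ∈ Set.Icc a b, l ^ 2 ≤ g₁ x) :
    ‖∫ x in a..b, w x * exp (I * (h x : ℂ))‖ ≤ 7 / l := by
  have hE : ∀ x, HasDerivAt (fun x => exp (I * (h x : ℂ)))
      (exp (I * (h x : ℂ)) * (I * (g x : ℂ))) x := fun x =>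
    (((hh x).ofReal_comp).const_mul I).cexp
  have hcont : Continuous fun x => w x * exp (I * (h x : ℂ)) :=
    (continuous_iff_continuousAt.2 fun x => (hw x).continuousAt).mul
      (continuous_iff_continuousAt.2 fun x => (hE x).continuousAt)
  have hnE : ∀ x, ‖exp (I * (h x : ℂ))‖ = 1 := fun x => by
    rw [mul_comm]; exact norm_exp_ofReal_mul_I _
  have hgpos : ∀ x ∈ Set.Icc a b, 0 < g x := fun x hx => hl.trans_le (bg x hx)
  have hmg : ∀ x ∈ Set.Icc a b, m ≤ g x := fun x hx => hml.trans (bg x hx)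
  set F : ℝ → ℂ := fun x =>
    exp (I * (h x : ℂ)) * (-I * w x * (g x : ℂ)⁻¹ + w₁ x * ((g x : ℂ)⁻¹) ^ 2) with hF
  have hFn : ∀ x ∈ Set.Icc a b, ‖F x‖ ≤ 2 / l := by
    intro x hx
    have h0 := hgpos x hx
    have h1 : (g x)⁻¹ ≤ l⁻¹ := inv_anti₀ hl (bg x hx)
    have h2 : ‖w₁ x‖ * (g x)⁻¹ ≤ 1 := by
      rw [← div_eq_mul_inv, div_le_one h0]
      exact (bw₁ x hx).trans (hmg x hx)
    have hinv : 0 < (g x)⁻¹ := inv_pos.2 h0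
    calc ‖F x‖ ≤ ‖w x‖ * (g x)⁻¹ + ‖w₁ x‖ * (g x)⁻¹ ^ 2 := by
          rw [hF, norm_mul, hnE, one_mul]
          refine (norm_add_le _ _).trans (le_of_eq ?_)
          simp [abs_of_pos h0]
      _ ≤ 2 * (g x)⁻¹ := by nlinarith [mul_le_mul_of_nonneg_right (bw x hx) hinv.le,
          mul_le_mul_of_nonneg_right h2 hinv.le]
      _ ≤ 2 / l := by rw [div_eq_mul_inv]; linarith
  have hFd : ∀ x ∈ Set.Icc a b, HasDerivAt F (exp (I * (h x : ℂ)) *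
      (w x + (I * w x * g₁ x * ((g x : ℂ)⁻¹) ^ 2 + w₂ x * ((g x : ℂ)⁻¹) ^ 2
        - 2 * w₁ x * g₁ x * ((g x : ℂ)⁻¹) ^ 3))) x := by
    intro x hx
    have h0 : (g x : ℂ) ≠ 0 := by exact_mod_cast (hgpos x hx).ne'
    have hi : HasDerivAt (fun x => (g x : ℂ)⁻¹) (-(g₁ x : ℂ) / (g x : ℂ) ^ 2) x :=
      ((hg x).ofReal_comp).fun_inv h0
    have := (hE x).mul ((((hw x).const_mul (-I)).mul hi).add ((hw₁ x).mul (hi.fun_pow 2)))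
    refine this.congr_deriv ?_
    simp only [Pi.add_apply, Pi.mul_apply, Nat.add_one_sub_one, pow_one]
    field_simp
    push_cast
    ring_nf
    simp only [I_sq]
    ring
  set G : ℝ → ℝ := fun x => -2 * (g x)⁻¹ - m * (g x)⁻¹ ^ 2 with hG
  have hGd : ∀ x ∈ Set.Icc a b, HasDerivAt G
      (2 * (g₁ x * (g x)⁻¹ ^ 2) + 2 * m * (g₁ x * (g x)⁻¹ ^ 3)) x := by
    intro x hx
    have h0 : g x ≠ 0 := (hgpos x hx).ne'
    have hi := (hg x).fun_inv h0
    refine ((hi.const_mul (-2)).sub ((hi.fun_pow 2).const_mul m)).congr_deriv ?_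
    simp only [Nat.add_one_sub_one, pow_one]
    field_simp
    push_cast
    ring
  have key : ‖(∫ x in a..b, w x * exp (I * (h x : ℂ))) - (F b - F a)‖ ≤ G b - G a := by
    have hd : ∀ x ∈ Set.Icc a b, HasDerivAt
        (fun y => (∫ x in a..y, w x * exp (I * (h x : ℂ))) - (F y - F a))
        (-(exp (I * (h x : ℂ)) * (I * w x * g₁ x * ((g x : ℂ)⁻¹) ^ 2
          + w₂ x * ((g x : ℂ)⁻¹) ^ 2 - 2 * w₁ x * g₁ x * ((g x : ℂ)⁻¹) ^ 3))) x := by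
      intro x hx
      refine ((intervalIntegral.integral_hasDerivAt_right (hcont.intervalIntegrable _ _)
        (hcont.stronglyMeasurableAtFilter _ _) hcont.continuousAt).sub
        ((hFd x hx).sub_const (F a))).congr_deriv ?_
      ring
    refine image_norm_le_of_norm_deriv_right_le_deriv_boundary'
      (f := fun y => (∫ x in a..y, w x * exp (I * (h x : ℂ))) - (F y - F a))
      (B := fun y => G y - G a)
      (fun x hx => (hd x hx).continuousAt.continuousWithinAt)
      (fun x hx => (hd x (Set.Ico_subset_Icc_self hx)).hasDerivWithinAt) (by simp)
      (fun x hx => ((hGd x hx).sub_const _).continuousAt.continuousWithinAt)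
      (fun x hx => ((hGd x (Set.Ico_subset_Icc_self hx)).sub_const _).hasDerivWithinAt)
      (fun x hx => ?_) ⟨hab, le_rfl⟩
    replace hx := Set.Ico_subset_Icc_self hx
    have h0 := hgpos x hx
    have hg₁ : 0 ≤ g₁ x := (sq_nonneg l).trans (bg₁ x hx)
    have hinv : 0 < (g x)⁻¹ := inv_pos.2 h0
    have h2 : ‖w₂ x‖ ≤ g₁ x :=
      (bw₂ x hx).trans ((pow_le_pow_left₀ hm hml 2).trans (bg₁ x hx))
    rw [norm_neg, norm_mul, hnE, one_mul]
    calc _ ≤ ‖w x‖ * (g₁ x * (g x)⁻¹ ^ 2) + ‖w₂ x‖ * (g x)⁻¹ ^ 2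
          + 2 * ‖w₁ x‖ * (g₁ x * (g x)⁻¹ ^ 3) := by
          refine (norm_sub_le _ _).trans ((add_le_add_left (norm_add_le _ _) _).trans
            (le_of_eq ?_))
          simp [abs_of_pos h0, abs_of_nonneg hg₁, mul_assoc]
      _ ≤ 1 * (g₁ x * (g x)⁻¹ ^ 2) + g₁ x * (g x)⁻¹ ^ 2
          + 2 * m * (g₁ x * (g x)⁻¹ ^ 3) := by
          gcongr
          · exact bw x hx
          · exact bw₁ x hx
      _ = _ := by ring
  have ha : a ∈ Set.Icc a b := ⟨le_rfl, hab⟩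
  have hb : b ∈ Set.Icc a b := ⟨hab, le_rfl⟩
  have hGb : G b ≤ 0 := by
    have := inv_pos.2 (hgpos b hb)
    have := mul_nonneg hm (sq_nonneg (g b)⁻¹)
    simp only [hG]; linarith
  have hGa : -G a ≤ 3 / l := by
    have h0 := hgpos a ha
    have h1 : (g a)⁻¹ ≤ l⁻¹ := inv_anti₀ hl (bg a ha)
    have h2 : m * (g a)⁻¹ ≤ 1 := by
      rw [← div_eq_mul_inv, div_le_one h0]; exact hmg a ha
    have h3 := mul_le_mul_of_nonneg_right h2 (inv_pos.2 h0).le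
    simp only [hG, div_eq_mul_inv]; nlinarith
  have hFa := hFn a ha
  have hFb := hFn b hb
  calc _ ≤ ‖(∫ x in a..b, w x * exp (I * (h x : ℂ))) - (F b - F a)‖ + ‖F b - F a‖ :=
        norm_le_norm_sub_add _ _
    _ ≤ (G b - G a) + (‖F b‖ + ‖F a‖) := add_le_add key (norm_sub_le _ _)
    _ ≤ 3 / l + (2 / l + 2 / l) := by linarith
    _ = 7 / l := by ring

/-- One-sided second-derivative test at a stationary point, for an amplitude varying on a scale
no shorter than that of the oscillation. -/
theorem norm_integral_exp_le_of_stationary_left {c b m l : ℝ} (hcb : c ≤ b) (hl : 0 < l)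
    (hml : m ≤ l) (hm : 0 ≤ m) {w w₁ w₂ : ℝ → ℂ} {h g g₁ : ℝ → ℝ}
    (hw : ∀ x, HasDerivAt w (w₁ x) x) (hw₁ : ∀ x, HasDerivAt w₁ (w₂ x) x)
    (hh : ∀ x, HasDerivAt h (g x) x) (hg : ∀ x, HasDerivAt g (g₁ x) x) (hgc : g c = 0)
    (bw : ∀ x ∈ Set.Icc c b, ‖w x‖ ≤ 1) (bw₁ : ∀ x ∈ Set.Icc c b, ‖w₁ x‖ ≤ m)
    (bw₂ : ∀ x ∈ Set.Icc c b, ‖w₂ x‖ ≤ m ^ 2)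
    (bg₁ : ∀ x ∈ Set.Icc c b, l ^ 2 ≤ g₁ x) :
    ‖∫ x in c..b, w x * exp (I * (h x : ℂ))‖ ≤ 8 / l := by
  have hcont : Continuous fun x => w x * exp (I * (h x : ℂ)) := by
    have h1 : Continuous w := continuous_iff_continuousAt.2 fun x => (hw x).continuousAt
    have h2 : Continuous h := continuous_iff_continuousAt.2 fun x => (hh x).continuousAt
    fun_prop
  have htriv : ∀ d ∈ Set.Icc c b, ‖∫ x in c..d, w x * exp (I * (h x : ℂ))‖ ≤ d - c := by
    intro d hd
    have := intervalIntegral.norm_integral_le_of_norm_le_const (a := c) (b := d) (C := 1)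
      (f := fun x => w x * exp (I * (h x : ℂ))) (fun x hx => by
        rw [Set.uIoc_of_le hd.1] at hx
        rw [norm_mul, mul_comm I, norm_exp_ofReal_mul_I, mul_one]
        exact bw x ⟨hx.1.le, hx.2.trans hd.2⟩)
    rwa [one_mul, abs_of_nonneg (sub_nonneg.2 hd.1)] at this
  have hl' : 0 < l⁻¹ := inv_pos.2 hl
  rcases le_total b (c + l⁻¹) with hb | hb
  · refine (htriv b ⟨hcb, le_rfl⟩).trans ?_
    rw [div_eq_mul_inv]; linarith
  have hsub : Set.Icc (c + l⁻¹) b ⊆ Set.Icc c b := Set.Icc_subset_Icc_left (by linarith)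
  have bg : ∀ x ∈ Set.Icc (c + l⁻¹) b, l ≤ g x := by
    intro x hx
    have := (convex_Icc c b).mul_sub_le_image_sub_of_le_deriv (f := g)
      (fun x _ => (hg x).continuousAt.continuousWithinAt)
      (fun x _ => (hg x).differentiableAt.differentiableWithinAt) (C := l ^ 2)
      (fun y hy => by rw [(hg y).deriv]; exact bg₁ y (interior_subset hy))
      c ⟨le_rfl, hcb⟩ x (hsub hx) (hsub hx).1
    rw [hgc, sub_zero] at this
    refine le_trans ?_ this
    calc l = l ^ 2 * l⁻¹ := by field_simp
      _ ≤ _ := by gcongr; linarith [hx.1]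
  have h2 := norm_integral_exp_le_of_le_deriv hb hl hml hm hw hw₁ hh hg
    (fun x hx => bw x (hsub hx)) (fun x hx => bw₁ x (hsub hx))
    (fun x hx => bw₂ x (hsub hx)) bg (fun x hx => bg₁ x (hsub hx))
  have h1 := htriv (c + l⁻¹) ⟨by linarith, hb⟩
  rw [← intervalIntegral.integral_add_adjacent_intervals
    (hcont.intervalIntegrable c (c + l⁻¹)) (hcont.intervalIntegrable _ b)]
  refine (norm_add_le _ _).trans ?_
  rw [div_eq_mul_inv] at h2 ⊢
  linarith

/-- Second-derivative test around a stationary point, for an amplitude varying on a scale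
no shorter than that of the oscillation. -/
theorem norm_integral_exp_le_of_stationary {a b c m l : ℝ} (hc : c ∈ Set.Icc a b) (hl : 0 < l)
    (hml : m ≤ l) (hm : 0 ≤ m) {w w₁ w₂ : ℝ → ℂ} {h g g₁ : ℝ → ℝ}
    (hw : ∀ x, HasDerivAt w (w₁ x) x) (hw₁ : ∀ x, HasDerivAt w₁ (w₂ x) x)
    (hh : ∀ x, HasDerivAt h (g x) x) (hg : ∀ x, HasDerivAt g (g₁ x) x) (hgc : g c = 0)
    (bw : ∀ x ∈ Set.Icc a b, ‖w x‖ ≤ 1) (bw₁ : ∀ x ∈ Set.Icc a b, ‖w₁ x‖ ≤ m)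
    (bw₂ : ∀ x ∈ Set.Icc a b, ‖w₂ x‖ ≤ m ^ 2)
    (bg₁ : ∀ x ∈ Set.Icc a b, l ^ 2 ≤ g₁ x) :
    ‖∫ x in a..b, w x * exp (I * (h x : ℂ))‖ ≤ 16 / l := by
  have hcont : Continuous fun x => w x * exp (I * (h x : ℂ)) := by
    have h1 : Continuous w := continuous_iff_continuousAt.2 fun x => (hw x).continuousAt
    have h2 : Continuous h := continuous_iff_continuousAt.2 fun x => (hh x).continuousAt
    fun_prop
  have hr : Set.Icc c b ⊆ Set.Icc a b := Set.Icc_subset_Icc_left hc.1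
  have hright := norm_integral_exp_le_of_stationary_left hc.2 hl hml hm hw hw₁ hh hg hgc
    (fun x hx => bw x (hr hx)) (fun x hx => bw₁ x (hr hx))
    (fun x hx => bw₂ x (hr hx)) (fun x hx => bg₁ x (hr hx))
  have hn : ∀ x ∈ Set.Icc (-c) (-a), -x ∈ Set.Icc a b := fun x hx =>
    ⟨by linarith [hx.2], by linarith [hx.1, hc.2]⟩
  have hleft := norm_integral_exp_le_of_stationary_left (c := -c) (b := -a)
    (w := fun x => w (-x)) (w₁ := fun x => -w₁ (-x)) (w₂ := fun x => w₂ (-x))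
    (h := fun x => h (-x)) (g := fun x => -g (-x)) (g₁ := fun x => g₁ (-x))
    (neg_le_neg hc.1) hl hml hm
    (fun x => ((hw (-x)).scomp x (hasDerivAt_neg x)).congr_deriv (by simp))
    (fun x => (((hw₁ (-x)).scomp x (hasDerivAt_neg x)).neg).congr_deriv (by simp))
    (fun x => ((hh (-x)).scomp x (hasDerivAt_neg x)).congr_deriv (by simp))
    (fun x => (((hg (-x)).scomp x (hasDerivAt_neg x)).neg).congr_deriv (by simp))
    (by simp [hgc])
    (fun x hx => bw _ (hn x hx)) (fun x hx => by rw [norm_neg]; exact bw₁ _ (hn x hx))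
    (fun x hx => bw₂ _ (hn x hx)) (fun x hx => bg₁ _ (hn x hx))
  rw [intervalIntegral.integral_comp_neg (fun x => w x * exp (I * (h x : ℂ))), neg_neg,
    neg_neg] at hleft
  rw [← intervalIntegral.integral_add_adjacent_intervals
    (hcont.intervalIntegrable a c) (hcont.intervalIntegrable c b)]
  refine (norm_add_le _ _).trans ((add_le_add hleft hright).trans (le_of_eq ?_))
  ring

/-- Stationary phase estimate: for every `A > 0` there are `J ∈ ℕ` and `C > 0` such that
for all `X, Y, Z, R > 0` with `Y/X² ≥ R ≥ 1`, every smooth `w : ℝ → ℂ` supported in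
`[Z, 2Z]` with `|w^{(j)}(ξ)| ≤ (X/Z)^j` for `0 ≤ j ≤ J`, and every smooth `h : ℝ → ℝ` with
`|h^{(j)}(ξ)| ≤ Y/Z^j` on `[Z, 2Z]` for `0 ≤ j ≤ J`, with `h''(ξ) ≥ Y/Z²` on `[Z, 2Z]`, and
with a stationary point `ξ₀ ∈ [Z, 2Z]` (`h'(ξ₀) = 0`), there is `κ ∈ ℂ`, `|κ| ≤ C`, with
`|∫ w(ξ) e^{i h(ξ)} dξ − κ e^{i h(ξ₀)} / √(h''(ξ₀))| ≤ C Z R^{-A}`. -/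
theorem stationary_phase (A : ℝ) (hA : 0 < A) :
    ∃ (J : ℕ) (C : ℝ), 0 < C ∧
      ∀ (X Y Z R : ℝ), 0 < X → 0 < Y → 0 < Z → 0 < R → R ≤ Y / X ^ 2 → 1 ≤ R →
      ∀ (w : ℝ → ℂ), ContDiff ℝ (⊤ : ℕ∞) w →
        Function.support w ⊆ Set.Icc Z (2 * Z) →
        (∀ j : ℕ, j ≤ J → ∀ ξ : ℝ, ‖iteratedDeriv j w ξ‖ ≤ (X / Z) ^ j) →
      ∀ (h : ℝ → ℝ), ContDiff ℝ (⊤ : ℕ∞) h →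
        (∀ j : ℕ, j ≤ J → ∀ ξ ∈ Set.Icc Z (2 * Z), |iteratedDeriv j h ξ| ≤ Y / Z ^ j) →
        (∀ ξ ∈ Set.Icc Z (2 * Z), Y / Z ^ 2 ≤ deriv (deriv h) ξ) →
      ∀ ξ₀ ∈ Set.Icc Z (2 * Z), deriv h ξ₀ = 0 →
      ∃ κ : ℂ, ‖κ‖ ≤ C ∧
        ‖(∫ ξ : ℝ, w ξ * Complex.exp (Complex.I * (h ξ : ℂ)))
            - κ * Complex.exp (Complex.I * (h ξ₀ : ℂ))
              / (Real.sqrt (deriv (deriv h) ξ₀) : ℂ)‖ ≤ C * Z * R ^ (-A) := by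
  refine ⟨2, 16, by norm_num, ?_⟩
  intro X Y Z R hX hY hZ hR hRY hR1 w hw hsupp bw h hh bh bh2 ξ₀ hξ₀ hstat
  have hZZ : Z ≤ 2 * Z := by linarith
  have hdw : ∀ x, HasDerivAt w (deriv w x) x := fun x =>
    ((hw.differentiable (by simp)) x).hasDerivAt
  have hdw₁ : ∀ x, HasDerivAt (deriv w) (deriv (deriv w) x) x := fun x =>
    (((contDiff_infty_iff_deriv.1 hw).2.differentiable (by simp)) x).hasDerivAt
  have hdh : ∀ x, HasDerivAt h (deriv h x) x := fun x =>
    ((hh.differentiable (by simp)) x).hasDerivAt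
  have hdh₁ : ∀ x, HasDerivAt (deriv h) (deriv (deriv h) x) x := fun x =>
    (((contDiff_infty_iff_deriv.1 hh).2.differentiable (by simp)) x).hasDerivAt
  have hiter {E : Type} [NormedAddCommGroup E] [NormedSpace ℝ E] (f : ℝ → E) :
      iteratedDeriv 2 f = deriv (deriv f) := by
    rw [iteratedDeriv_succ, iteratedDeriv_one]
  have hXY : X ≤ √Y := by
    apply Real.le_sqrt_of_sq_le
    have := (le_div_iff₀ (by positivity)).1 (hR1.trans hRY)
    linarith
  have hsY : 0 < √Y := Real.sqrt_pos.2 hY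
  have hl2 : (√Y / Z) ^ 2 = Y / Z ^ 2 := by rw [div_pow, Real.sq_sqrt hY.le]
  have hI := norm_integral_exp_le_of_stationary (l := √Y / Z) (m := X / Z) hξ₀ (by positivity)
    (by gcongr) (by positivity) hdw hdw₁ hdh hdh₁ hstat
    (fun x _ => by simpa using bw 0 (by norm_num) x)
    (fun x _ => by simpa using bw 1 (by norm_num) x)
    (fun x _ => by simpa [hiter] using bw 2 le_rfl x)
    (fun x hx => by rw [hl2]; exact bh2 x hx)
  have hfull : ∫ ξ : ℝ, w ξ * exp (I * (h ξ : ℂ))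
      = ∫ ξ in Z..(2 * Z), w ξ * exp (I * (h ξ : ℂ)) := by
    rw [intervalIntegral.integral_of_le hZZ, ← integral_Icc_eq_integral_Ioc]
    refine (setIntegral_eq_integral_of_forall_compl_eq_zero fun x hx => ?_).symm
    rw [Function.notMem_support.1 fun hx' => hx (hsupp hx'), zero_mul]
  rw [← hfull] at hI
  set S : ℂ := ∫ ξ : ℝ, w ξ * exp (I * (h ξ : ℂ)) with hS
  set D : ℝ := deriv (deriv h) ξ₀ with hD
  have hDpos : 0 < D := lt_of_lt_of_le (by positivity) (bh2 ξ₀ hξ₀)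
  have hDle : √D ≤ √Y / Z := by
    apply Real.sqrt_le_iff.2 ⟨by positivity, ?_⟩
    rw [hl2]
    have := bh 2 le_rfl ξ₀ hξ₀
    rw [hiter] at this
    exact (le_abs_self _).trans this
  have hsD : (√D : ℂ) ≠ 0 := by exact_mod_cast (Real.sqrt_pos.2 hDpos).ne'
  refine ⟨S * √D * exp (-(I * (h ξ₀ : ℂ))), ?_, ?_⟩
  · have hn : ‖exp (-(I * (h ξ₀ : ℂ)))‖ = 1 := by
      rw [exp_neg, norm_inv, mul_comm I, norm_exp_ofReal_mul_I, inv_one]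
    rw [norm_mul, norm_mul, hn, mul_one, norm_real, Real.norm_of_nonneg (Real.sqrt_nonneg _)]
    calc ‖S‖ * √D ≤ 16 / (√Y / Z) * (√Y / Z) := by gcongr
      _ = 16 := by field_simp
  · have hz : S - S * √D * exp (-(I * (h ξ₀ : ℂ))) * exp (I * (h ξ₀ : ℂ)) / (√D : ℂ) = 0 := by
      rw [mul_assoc, ← exp_add, neg_add_cancel, exp_zero, mul_one, mul_div_cancel_right₀ _ hsD,
        sub_self]
    rw [hz, norm_zero]
    positivity
end

section
/- Let r ≥ 1 be an integer, let n ∈ ℤ, let K > 0 be a real number, and let W : ℝ → ℂ be a smooth function with compact support contained in (0, ∞). Then ∑_{k ∈ ℤ, gcd(k,r)=1} e(n·\bar{k}/r) · W(k/K) = (K/r) · ∑_{m ∈ ℤ} S(m, n; r) · Ŵ(mK/r), where for each k coprime to r, \bar{k} denotes any integer with k·\bar{k} ≡ 1 (mod r) (the summand e(n·\bar{k}/r) does not depend on the choice of \bar{k}). -/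
open MeasureTheory Complex

/-- `e(x) = exp(2πix)`. -/
noncomputable def eAdd (x : ℝ) : ℂ := Complex.exp (2 * Real.pi * Complex.I * x)

/-- The classical Kloosterman sum `S(a, b; c) = ∑_{x mod c, (x,c)=1} e((a x + b x̄)/c)`. -/
noncomputable def kloostermanS (a b : ℤ) (c : ℕ) : ℂ :=
  ∑ x ∈ Finset.filter (fun x : ℕ => Nat.Coprime x c) (Finset.range c),
    eAdd (((a * x + b * (((x : ZMod c)⁻¹).val : ℤ) : ℤ) : ℝ) / c)

open scoped FourierTransform in
theorem SchwartzMap.summable_norm_int (f : SchwartzMap ℝ ℂ) : Summable fun k : ℤ => ‖f k‖ :=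
  summable_of_isBigO (Real.summable_abs_int_rpow one_lt_two)
    ((f.isBigO_cocompact_rpow (-2)).norm_left.comp_tendsto Int.tendsto_coe_cofinite)

theorem eAdd_add (x y : ℝ) : eAdd (x + y) = eAdd x * eAdd y := by
  simp only [eAdd, ← Complex.exp_add]
  congr 1
  push_cast
  ring

theorem norm_eAdd (x : ℝ) : ‖eAdd x‖ = 1 := by
  rw [eAdd, show (2 * Real.pi * Complex.I * x : ℂ) = ((2 * Real.pi * x : ℝ) : ℂ) * Complex.I by
    push_cast; ring]
  exact Complex.norm_exp_ofReal_mul_I _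

theorem eAdd_intCast (k : ℤ) : eAdd k = 1 := by
  rw [eAdd, Complex.exp_eq_one_iff]
  exact ⟨k, by push_cast; ring⟩

theorem eAdd_div_congr {r : ℕ} (hr : r ≠ 0) {a b : ℤ} (h : a ≡ b [ZMOD r]) :
    eAdd ((a : ℝ) / r) = eAdd ((b : ℝ) / r) := by
  obtain ⟨c, hc⟩ := h.dvd
  have hr' : (r : ℝ) ≠ 0 := by exact_mod_cast hr
  have hb : (b : ℝ) / r = a / r + c := by
    rw [show b = a + r * c by lia]
    push_cast
    field_simp
  rw [hb, eAdd_add, eAdd_intCast, mul_one]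

theorem tsum_int_eq_sum_residues {r : ℕ} (hr : r ≠ 0) {F : ℤ → ℂ} (hF : Summable F) :
    ∑' k, F k = ∑ a ∈ Finset.range r, ∑' j : ℤ, F (a + r * j) := by
  have : NeZero r := ⟨hr⟩
  have key : ∀ p : Fin r × ℤ,
      ((Equiv.prodComm _ _).trans (Int.divModEquiv r).symm) p = (p.1 : ℕ) + r * p.2 := by
    rintro ⟨a, j⟩
    simp [Int.divModEquiv]
    ring
  have hS := ((Equiv.prodComm _ _).trans (Int.divModEquiv r).symm).summable_iff.mpr hF
  rw [← ((Equiv.prodComm _ _).trans (Int.divModEquiv r).symm).tsum_eq F,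
    Summable.tsum_prod (f := fun p => F (((Equiv.prodComm _ _).trans (Int.divModEquiv r).symm) p))
      hS, tsum_fintype, Finset.sum_range]
  simp only [key]

open scoped FourierTransform in
theorem fourier_comp_mul_eq {c : ℝ} (hc : 0 < c) (W : ℝ → ℂ) (m : ℝ) :
    𝓕 (fun t => W (c * t)) m = (c : ℂ)⁻¹ * ∫ x : ℝ, W x * eAdd (-(x * (m / c))) := by
  have h := Measure.integral_comp_mul_left (fun x : ℝ => W x * eAdd (-(x * (m / c)))) c
  rw [abs_of_pos (inv_pos.mpr hc), Complex.real_smul, Complex.ofReal_inv] at h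
  rw [← h, Real.fourier_real_eq_integral_exp_smul]
  refine integral_congr_ae (.of_forall fun t => ?_)
  simp only [smul_eq_mul, eAdd]
  rw [mul_comm]
  congr 2
  have : (c : ℂ) ≠ 0 := by exact_mod_cast hc.ne'
  push_cast
  field_simp

/-- Poisson summation over the progression `a + r ℤ`. -/
theorem SchwartzMap.tsum_residue_eq {r : ℕ} (f : SchwartzMap ℝ ℂ) (a : ℕ) :
    ∑' j : ℤ, f (j + a / r)
      = ∑' m : ℤ, eAdd (((m * a : ℤ) : ℝ) / r) * FourierTransform.fourier (f : ℝ → ℂ) m := by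
  simp_rw [add_comm _ ((a : ℝ) / r)]
  rw [f.tsum_eq_tsum_fourier]
  refine tsum_congr fun m => ?_
  rw [fourier_coe_apply, mul_comm, eAdd, SchwartzMap.fourier_coe]
  congr 2
  push_cast
  ring

/-- Poisson-type summation for sums of `e(n k̄ / r) W(k/K)` over `k` coprime to `r`:
`∑_{(k,r)=1} e(n k̄ / r) W(k/K) = (K/r) ∑_m S(m, n; r) Ŵ(mK/r)`. -/
theorem kloosterman_poisson_summation
    (r : ℕ) (hr : 1 ≤ r) (n : ℤ) (K : ℝ) (hK : 0 < K)
    (W : ℝ → ℂ) (hW : ContDiff ℝ (⊤ : ℕ∞) W) (hWc : HasCompactSupport W)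
    (hWsupp : Function.support W ⊆ Set.Ioi (0 : ℝ))
    (kinv : ℤ → ℤ)
    (hkinv : ∀ k : ℤ, Int.gcd k (r : ℤ) = 1 → (k * kinv k) ≡ 1 [ZMOD (r : ℤ)]) :
    (∑' k : ℤ, if Int.gcd k (r : ℤ) = 1 then
        eAdd (((n * kinv k : ℤ) : ℝ) / r) * W ((k : ℝ) / K) else 0)
      = ((K : ℂ) / r) * ∑' m : ℤ, kloostermanS m n r *
          ∫ x : ℝ, W x * eAdd (-(x * ((m : ℝ) * K / r))) := by
  have hr0 : r ≠ 0 := by lia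
  have : NeZero r := ⟨hr0⟩
  have hrR : (0 : ℝ) < r := by exact_mod_cast hr
  have dil : ∀ c : ℝ, 0 < c → ∃ f : SchwartzMap ℝ ℂ, ∀ t, f t = W (c * t) := fun c hc =>
    ⟨(hWc.comp_homeomorph (Homeomorph.mulLeft₀ c hc.ne')).toSchwartzMap
      (hW.comp (contDiff_const.mul contDiff_id)), fun t => rfl⟩
  have hK' : (K : ℂ) ≠ 0 := by exact_mod_cast hK.ne'
  have hr' : (r : ℂ) ≠ 0 := by exact_mod_cast hr0
  obtain ⟨f, hf⟩ := dil K⁻¹ (inv_pos.mpr hK)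
  obtain ⟨g, hg⟩ := dil (r / K) (by positivity)
  have hgW : (g : ℝ → ℂ) = fun t => W (r / K * t) := funext hg
  have hI : ∀ m : ℤ, (∫ x : ℝ, W x * eAdd (-(x * ((m : ℝ) * K / r))))
      = (r / K : ℂ) * FourierTransform.fourier (g : ℝ → ℂ) m := fun m => by
    rw [hgW, fourier_comp_mul_eq (by positivity), div_div_eq_mul_div,
      ← mul_assoc, Complex.ofReal_div, Complex.ofReal_natCast,
      mul_inv_cancel₀ (div_ne_zero hr' hK'), one_mul]
  have hLsum : Summable fun k : ℤ => if Int.gcd k (r : ℤ) = 1 then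
        eAdd (((n * kinv k : ℤ) : ℝ) / r) * W ((k : ℝ) / K) else 0 := by
    refine Summable.of_norm_bounded f.summable_norm_int fun k => ?_
    split_ifs
    · rw [norm_mul, norm_eAdd, one_mul, hf, div_eq_inv_mul]
    · simp
  have hgsum : Summable fun m : ℤ => ‖FourierTransform.fourier (g : ℝ → ℂ) m‖ := by
    rw [← SchwartzMap.fourier_coe]
    exact SchwartzMap.summable_norm_int _
  have hterm : ∀ a : ℕ, a.Coprime r → ∀ j : ℤ, (if Int.gcd (a + r * j) (r : ℤ) = 1 then
        eAdd (((n * kinv (a + r * j) : ℤ) : ℝ) / r) * W (((a + r * j : ℤ) : ℝ) / K) else 0)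
      = eAdd (((n * (((a : ZMod r)⁻¹).val : ℤ) : ℤ) : ℝ) / r) * g (j + a / r) := by
    intro a ha j
    have hgcd : Int.gcd (a + r * j) (r : ℤ) = 1 := by simpa using ha
    rw [if_pos hgcd, hg]
    congr 1
    · refine eAdd_div_congr hr0 (Int.ModEq.mul_left n ?_)
      have h := hkinv _ hgcd
      rw [← ZMod.intCast_eq_intCast_iff] at h ⊢
      push_cast at h ⊢
      rw [ZMod.natCast_self, zero_mul, add_zero] at h
      rw [ZMod.natCast_zmod_val]
      exact (ZMod.inv_eq_of_mul_eq_one r _ _ h).symm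
    · congr 1
      push_cast
      field_simp
      ring
  have hzero : ∀ a : ℕ, ¬ a.Coprime r → ∀ j : ℤ, (if Int.gcd (a + r * j) (r : ℤ) = 1 then
        eAdd (((n * kinv (a + r * j) : ℤ) : ℝ) / r) * W (((a + r * j : ℤ) : ℝ) / K) else 0)
      = 0 := by
    intro a ha j
    exact if_neg (by simpa using ha)
  calc _ = ∑ a ∈ Finset.range r, if a.Coprime r then
          eAdd (((n * (((a : ZMod r)⁻¹).val : ℤ) : ℤ) : ℝ) / r) * ∑' j : ℤ, g (j + a / r)
          else 0 := by
        rw [tsum_int_eq_sum_residues hr0 hLsum]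
        refine Finset.sum_congr rfl fun a _ => ?_
        split_ifs with ha
        · rw [← tsum_mul_left]
          exact tsum_congr (hterm a ha)
        · rw [tsum_congr (hzero a ha), tsum_zero]
    _ = ∑ a ∈ Finset.range r with a.Coprime r, ∑' m : ℤ,
          eAdd (((m * a + n * (((a : ZMod r)⁻¹).val : ℤ) : ℤ) : ℝ) / r) *
            FourierTransform.fourier (g : ℝ → ℂ) m := by
        rw [Finset.sum_filter]
        refine Finset.sum_congr rfl fun a _ => ?_
        congr 1
        rw [g.tsum_residue_eq, ← tsum_mul_left]
        refine tsum_congr fun m => ?_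
        rw [Int.cast_add, add_div, eAdd_add]
        ring
    _ = ∑' m : ℤ, kloostermanS m n r * FourierTransform.fourier (g : ℝ → ℂ) m := by
        rw [← Summable.tsum_finsetSum fun a _ => ?_]
        · simp_rw [kloostermanS, Finset.sum_mul]
        · refine Summable.of_norm_bounded hgsum fun m => ?_
          rw [norm_mul, norm_eAdd, one_mul]
    _ = _ := by
        rw [← tsum_mul_left]
        refine tsum_congr fun m => ?_
        rw [hI]
        field_simp
end

section
/- Fix a real number B ≥ 1. There exist C > 0 and T₀ ≥ 2 such that for all T ≥ T₀, all real t with T ≤ |t| ≤ 2T, and all κ ∈ ℂ with |κ| ≤ B and Re(κ) < 1/2, there exists δ ∈ ℂ with |δ| ≤ C·T^{−1} such that Γ((1/2 − it − κ)/2) / Γ((1/2 + it − κ)/2) = (|t|/(2e))^{−it} · e^{iπ·sgn(t)·(1/4 + κ/2)} · (1 + δ). -/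
open Complex

/-- The main term `(s - 1/2) log s - s` of Stirling's formula for `log Γ(s)`, without the
constant `log √(2π)`. -/
noncomputable def stirlingMain (s : ℂ) : ℂ := (s - 1 / 2) * log s - s

/-- The defect of `stirlingMain` in the functional equation `log Γ(s + 1) = log s + log Γ(s)`. -/
noncomputable def stirlingDefect (s : ℂ) : ℂ := (s + 1 / 2) * (log (s + 1) - log s) - 1

lemma log_mul_of_re_nonneg_of_re_pos {w v : ℂ} (hw : w ≠ 0) (hwr : 0 ≤ w.re) (hv : 0 < v.re) :
    log (w * v) = log w + log v := by
  have hv0 : v ≠ 0 := fun h => by simp [h] at hv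
  have h1 := abs_le.mp (abs_arg_le_pi_div_two_iff.mpr hwr)
  have h2 := abs_lt.mp (abs_arg_lt_pi_div_two_iff.mpr (Or.inl hv))
  exact log_mul hw hv0 ⟨by linarith [h1.1, h2.1], by linarith [h1.2, h2.2]⟩

lemma log_add_eq_log_add_log_one_add_div {w a : ℂ} (hwr : 0 ≤ w.re) (h : ‖a‖ < ‖w‖) :
    log (w + a) = log w + log (1 + a / w) := by
  have hw : w ≠ 0 := norm_pos_iff.mp ((norm_nonneg a).trans_lt h)
  have hlt : ‖a / w‖ < 1 := by
    rw [norm_div, div_lt_one (norm_pos_iff.mpr hw)]; exact h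
  have hre : 0 < (1 + a / w).re := by
    have := (abs_le.mp (abs_re_le_norm (a / w))).1
    rw [add_re, one_re]; linarith
  rw [← log_mul_of_re_nonneg_of_re_pos hw hwr hre]
  congr 1
  field_simp

lemma norm_stirlingDefect_le {s : ℂ} (hre : 0 ≤ s.re) (hs : 2 ≤ ‖s‖) :
    ‖stirlingDefect s‖ ≤ 2 / ‖s‖ ^ 2 := by
  have hs0 : s ≠ 0 := norm_pos_iff.mp (by linarith)
  have hlog : log (s + 1) - log s = log (1 + s⁻¹) := by
    rw [log_add_eq_log_add_log_one_add_div hre (by rw [norm_one]; linarith), one_div]; ring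
  set z := s⁻¹ with hz
  have hsz : s = z⁻¹ := by simp [hz]
  have hz0 : z ≠ 0 := inv_ne_zero hs0
  have hznorm : ‖z‖ ≤ 1 / 2 := by
    rw [hz, norm_inv, one_div]; exact inv_anti₀ (by norm_num) hs
  have htaylor := norm_log_sub_logTaylor_le 2 (z := z) (by linarith)
  set e := log (1 + z) - logTaylor (2 + 1) z with he
  have hpoly : logTaylor (2 + 1) z = z - z ^ 2 / 2 := by
    simp [logTaylor_succ, logTaylor_zero]; ring
  have hlog1 : log (1 + z) = z - z ^ 2 / 2 + e := by rw [he, hpoly]; ring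
  have hdefect : stirlingDefect s = -z ^ 2 / 4 + (1 + z / 2) * (e / z) := by
    rw [stirlingDefect, hlog, hlog1, hsz]
    field_simp
    ring
  have hpos : 0 < ‖z‖ := norm_pos_iff.mpr hz0
  have hinv : (1 - ‖z‖)⁻¹ ≤ 2 := by
    rw [show (2 : ℝ) = (1 / 2)⁻¹ by norm_num]
    exact inv_anti₀ (by norm_num) (by linarith)
  have hebound : ‖e / z‖ ≤ ‖z‖ ^ 2 := by
    rw [norm_div, div_le_iff₀ hpos]
    refine htaylor.trans ?_
    have : ‖z‖ ^ (2 + 1) * (1 - ‖z‖)⁻¹ ≤ ‖z‖ ^ (2 + 1) * 2 := by gcongr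
    push_cast
    nlinarith [pow_pos hpos 3]
  have hfac : ‖1 + z / 2‖ ≤ 5 / 4 := by
    refine (norm_add_le _ _).trans ?_
    rw [norm_one, norm_div, Complex.norm_ofNat]
    linarith
  have hgoal : 2 / ‖s‖ ^ 2 = 2 * ‖z‖ ^ 2 := by
    rw [hz, norm_inv]; field_simp
  rw [hgoal, hdefect]
  calc ‖-z ^ 2 / 4 + (1 + z / 2) * (e / z)‖
      ≤ ‖-z ^ 2 / 4‖ + ‖1 + z / 2‖ * ‖e / z‖ := by
        rw [← norm_mul]; exact norm_add_le _ _
    _ ≤ ‖z‖ ^ 2 / 4 + 5 / 4 * ‖z‖ ^ 2 := by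
        rw [norm_div, norm_neg, norm_pow, Complex.norm_ofNat]
        gcongr
    _ ≤ 2 * ‖z‖ ^ 2 := by nlinarith [sq_nonneg ‖z‖]

lemma sq_norm_add_natCast_ge {s : ℂ} (hre : 0 ≤ s.re) (n : ℕ) :
    ‖s‖ ^ 2 + (n : ℝ) ^ 2 ≤ ‖s + n‖ ^ 2 := by
  rw [← normSq_eq_norm_sq, ← normSq_eq_norm_sq, normSq_apply, normSq_apply]
  simp only [add_re, natCast_re, add_im, natCast_im]
  nlinarith [mul_nonneg hre (Nat.cast_nonneg (α := ℝ) n)]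

lemma norm_stirlingDefect_add_natCast_le {s : ℂ} (hre : 0 ≤ s.re) (hs : 2 ≤ ‖s‖) (n : ℕ) :
    ‖stirlingDefect (s + n)‖ ≤ 4 / (‖s‖ + n - 1) - 4 / (‖s‖ + (n + 1 : ℕ) - 1) := by
  have hsq := sq_norm_add_natCast_ge hre n
  have hn : (0 : ℝ) ≤ n := Nat.cast_nonneg n
  have h2 : 2 ≤ ‖s + n‖ := by nlinarith [norm_nonneg (s + n)]
  refine (norm_stirlingDefect_le (by simpa using by positivity) h2).trans ?_
  have h1 : 0 < ‖s‖ + n - 1 := by linarith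
  have h3 : 0 < ‖s‖ + n := by linarith
  have : 4 / (‖s‖ + n - 1) - 4 / (‖s‖ + (n + 1 : ℕ) - 1)
      = 4 / ((‖s‖ + n - 1) * (‖s‖ + n)) := by
    push_cast
    rw [show ‖s‖ + (n + 1) - 1 = ‖s‖ + (n : ℝ) by ring]
    field_simp
    ring
  rw [this, div_le_div_iff₀ (by positivity) (by positivity)]
  nlinarith [sq_nonneg (‖s‖ - n)]

lemma sum_norm_stirlingDefect_le {s : ℂ} (hre : 0 ≤ s.re) (hs : 2 ≤ ‖s‖) (N : ℕ) :
    ∑ n ∈ Finset.range N, ‖stirlingDefect (s + n)‖ ≤ 8 / ‖s‖ := by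
  have h1 : ∑ n ∈ Finset.range N, ‖stirlingDefect (s + n)‖
      ≤ 4 / (‖s‖ + (0 : ℕ) - 1) - 4 / (‖s‖ + N - 1) := by
    rw [← Finset.sum_range_sub' (fun n : ℕ => 4 / (‖s‖ + n - 1))]
    exact Finset.sum_le_sum fun n _ => norm_stirlingDefect_add_natCast_le hre hs n
  have hN : (0 : ℝ) ≤ N := Nat.cast_nonneg N
  have h2 : 0 ≤ 4 / (‖s‖ + N - 1) := div_nonneg (by norm_num) (by linarith)
  have h3 : 4 / (‖s‖ + (0 : ℕ) - 1) ≤ 8 / ‖s‖ := by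
    rw [Nat.cast_zero, add_zero, div_le_div_iff₀ (by linarith) (by linarith)]
    linarith
  linarith

lemma summable_norm_stirlingDefect {s : ℂ} (hre : 0 ≤ s.re) (hs : 2 ≤ ‖s‖) :
    Summable fun n : ℕ => ‖stirlingDefect (s + n)‖ :=
  summable_of_sum_range_le (fun _ => norm_nonneg _) (sum_norm_stirlingDefect_le hre hs)

lemma norm_tsum_stirlingDefect_le {s : ℂ} (hre : 0 ≤ s.re) (hs : 2 ≤ ‖s‖) :
    ‖∑' n : ℕ, stirlingDefect (s + n)‖ ≤ 8 / ‖s‖ :=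
  (norm_tsum_le_tsum_norm (summable_norm_stirlingDefect hre hs)).trans
    (Real.tsum_le_of_sum_range_le (fun _ => norm_nonneg _) (sum_norm_stirlingDefect_le hre hs))

/-- Shifting the argument of `stirlingMain`. -/
lemma norm_stirlingMain_add_sub_le {A : ℝ} (hA : 1 ≤ A) {w a : ℂ} (hwr : 0 ≤ w.re)
    (ha : ‖a‖ ≤ A) (hw : 2 * A ≤ ‖w‖) :
    ‖stirlingMain (w + a) - ((w + a - 1 / 2) * log w - w)‖ ≤ 4 * A ^ 2 / ‖w‖ := by
  have hwpos : 0 < ‖w‖ := by linarith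
  have hw0 : w ≠ 0 := norm_pos_iff.mp hwpos
  set u := a / w with hu
  have hau : a = w * u := by rw [hu]; field_simp
  have hunorm : ‖u‖ ≤ A / ‖w‖ := by rw [hu, norm_div]; gcongr
  have huhalf : ‖u‖ ≤ 1 / 2 := hunorm.trans (by rw [div_le_div_iff₀ hwpos two_pos]; linarith)
  have htaylor := norm_log_one_add_sub_self_le (z := u) (by linarith)
  set e := log (1 + u) - u with he
  have hinv : (1 - ‖u‖)⁻¹ ≤ 2 := by
    rw [show (2 : ℝ) = (1 / 2)⁻¹ by norm_num]
    exact inv_anti₀ (by norm_num) (by linarith)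
  have hebound : ‖e‖ ≤ (A / ‖w‖) ^ 2 := by
    calc ‖e‖ ≤ ‖u‖ ^ 2 * (1 - ‖u‖)⁻¹ / 2 := htaylor
      _ ≤ ‖u‖ ^ 2 * 2 / 2 := by gcongr
      _ = ‖u‖ ^ 2 := by ring
      _ ≤ _ := by gcongr
  have heq : stirlingMain (w + a) - ((w + a - 1 / 2) * log w - w)
      = (a - 1 / 2) * u + (w + (a - 1 / 2)) * e := by
    have hlog : log (1 + u) = u + e := by rw [he]; ring
    rw [stirlingMain, log_add_eq_log_add_log_one_add_div hwr (by linarith), ← hu, hlog]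
    linear_combination -hau
  have hb : ‖a - 1 / 2‖ ≤ 3 / 2 * A := by
    refine (norm_sub_le _ _).trans ?_
    norm_num
    linarith
  have hwb : ‖w + (a - 1 / 2)‖ ≤ 2 * ‖w‖ := by
    refine (norm_add_le _ _).trans ?_
    linarith
  rw [heq]
  calc ‖(a - 1 / 2) * u + (w + (a - 1 / 2)) * e‖
      ≤ ‖a - 1 / 2‖ * ‖u‖ + ‖w + (a - 1 / 2)‖ * ‖e‖ := by
        rw [← norm_mul, ← norm_mul]; exact norm_add_le _ _
    _ ≤ 3 / 2 * A * (A / ‖w‖) + 2 * ‖w‖ * (A / ‖w‖) ^ 2 := by gcongr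
    _ = 7 / 2 * A ^ 2 / ‖w‖ := by field_simp; ring
    _ ≤ 4 * A ^ 2 / ‖w‖ := by gcongr; norm_num

lemma sum_log_add_natCast (s : ℂ) (N : ℕ) :
    ∑ n ∈ Finset.range N, log (s + n)
      = stirlingMain (s + N) - stirlingMain s
        - ∑ n ∈ Finset.range N, stirlingDefect (s + n) := by
  induction N with
  | zero => simp
  | succ N ih =>
    rw [Finset.sum_range_succ, Finset.sum_range_succ, ih]
    simp only [stirlingMain, stirlingDefect]
    push_cast
    rw [← add_assoc]
    ring

open Filter Topology in
lemma tendsto_stirlingMain_add_natCast (a : ℂ) :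
    Tendsto (fun n : ℕ => stirlingMain (n + a) - ((n + a - 1 / 2) * log n - n)) atTop (𝓝 0) := by
  set A := ‖a‖ + 1 with hA
  have hlim : Tendsto (fun n : ℕ => 4 * A ^ 2 / (n : ℝ)) atTop (𝓝 0) :=
    tendsto_const_div_atTop_nhds_zero_nat _
  refine squeeze_zero_norm' ?_ hlim
  filter_upwards [tendsto_natCast_atTop_atTop.eventually_ge_atTop (2 * A)] with n hn
  have := norm_stirlingMain_add_sub_le (A := A) (w := n) (a := a)
    (by linarith [norm_nonneg a]) (by simp) (by linarith) (by simpa using hn)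
  simpa using this

lemma GammaSeq_eq_exp_stirlingMain {s : ℂ} (hs : 0 < s.re) {n : ℕ} (hn : n ≠ 0) :
    GammaSeq s n = (Real.sqrt 2 * Stirling.stirlingSeq n : ℝ)
      * exp (stirlingMain s + ∑ k ∈ Finset.range (n + 1), stirlingDefect (s + k)
        - (stirlingMain (n + (s + 1)) - ((n + (s + 1) - 1 / 2) * log n - n))) := by
  have hprod : ∏ k ∈ Finset.range (n + 1), (s + k)
      = exp (∑ k ∈ Finset.range (n + 1), log (s + k)) := by
    rw [exp_sum]
    refine Finset.prod_congr rfl fun k _ => (exp_log fun h => ?_).symm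
    have := congrArg re h
    simp only [add_re, natCast_re, zero_re] at this
    linarith [Nat.cast_nonneg (α := ℝ) k]
  have hn0 : (n : ℂ) ≠ 0 := Nat.cast_ne_zero.mpr hn
  have hnpos : (0 : ℝ) < n := Nat.cast_pos.mpr (Nat.pos_of_ne_zero hn)
  have hstirling : Real.sqrt 2 * Stirling.stirlingSeq n
      = n.factorial * Real.exp (n - (n + 1 / 2) * Real.log n) := by
    have hsqrt : Real.exp (1 / 2 * Real.log n) = Real.sqrt n := by
      rw [Real.sqrt_eq_rpow, Real.rpow_def_of_pos hnpos, mul_comm]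
    have hpow : Real.exp (n * Real.log n) = (n : ℝ) ^ n := by
      rw [Real.exp_nat_mul, Real.exp_log hnpos]
    have hexp : Real.exp n = Real.exp 1 ^ n := by rw [← Real.exp_nat_mul, mul_one]
    rw [Stirling.stirlingSeq, Real.exp_sub, add_mul, Real.exp_add, hsqrt, hpow, hexp,
      Real.sqrt_mul (by norm_num), div_pow]
    have := Real.sqrt_pos.mpr hnpos
    field_simp
  rw [GammaSeq, hprod, sum_log_add_natCast, hstirling, cpow_def_of_ne_zero hn0, div_eq_mul_inv,
    ← exp_neg]
  push_cast
  rw [mul_comm (exp _), mul_assoc, mul_assoc, ← exp_add, ← exp_add,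
    show s + ((n : ℂ) + 1) = n + (s + 1) by ring]
  congr 2
  ring

open Filter Topology in
/-- **Stirling's formula** for the complex Gamma function, with an explicit remainder. -/
theorem Gamma_eq_exp_stirlingMain {s : ℂ} (hre : 0 < s.re) (hs : 2 ≤ ‖s‖) :
    Gamma s = Real.sqrt (2 * Real.pi)
      * exp (stirlingMain s + ∑' n : ℕ, stirlingDefect (s + n)) := by
  refine tendsto_nhds_unique (GammaSeq_tendsto_Gamma s) ?_
  have hseq : Tendsto (fun n : ℕ => ((Real.sqrt 2 * Stirling.stirlingSeq n : ℝ) : ℂ)) atTop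
      (𝓝 (Real.sqrt (2 * Real.pi))) := by
    rw [Real.sqrt_mul (by norm_num)]
    exact (continuous_ofReal.tendsto _).comp (Stirling.tendsto_stirlingSeq_sqrt_pi.const_mul _)
  have hsum : Tendsto (fun n : ℕ => ∑ k ∈ Finset.range (n + 1), stirlingDefect (s + k)) atTop
      (𝓝 (∑' n : ℕ, stirlingDefect (s + n))) :=
    (summable_norm_stirlingDefect hre.le hs).of_norm.hasSum.tendsto_sum_nat.comp
      (tendsto_add_atTop_nat 1)
  have hexp := (continuous_exp.tendsto _).comp
    ((hsum.const_add (stirlingMain s)).sub (tendsto_stirlingMain_add_natCast (s + 1)))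
  rw [sub_zero] at hexp
  refine (hseq.mul hexp).congr' ?_
  filter_upwards [eventually_ne_atTop 0] with n hn
  exact (GammaSeq_eq_exp_stirlingMain hre hn).symm

lemma log_I_mul_ofReal {y : ℝ} (hy : y ≠ 0) :
    log (I * y) = Real.log |y| + Real.sign y * (Real.pi / 2) * I := by
  rcases hy.lt_or_gt with h | h
  · have : I * (y : ℂ) = ((|y| : ℝ) : ℂ) * -I := by rw [abs_of_neg h]; push_cast; ring
    rw [this, log_ofReal_mul (abs_pos.mpr hy) (neg_ne_zero.mpr I_ne_zero), log_neg_I,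
      Real.sign_of_neg h]
    push_cast
    ring
  · have : I * (y : ℂ) = ((|y| : ℝ) : ℂ) * I := by rw [abs_of_pos h]; ring
    rw [this, log_ofReal_mul (abs_pos.mpr hy) I_ne_zero, log_I, Real.sign_of_pos h]
    push_cast
    ring

/-- Stirling's formula on a vertical line, with base point on the imaginary axis. -/
lemma exists_Gamma_I_mul_add_eq {A : ℝ} (hA : 1 ≤ A) {a : ℂ} (ha : ‖a‖ ≤ A) (hre : 0 < a.re)
    {y : ℝ} (hyA : 2 * A ≤ |y|) (hy4 : 4 ≤ |y|) :
    ∃ ε : ℂ, ‖ε‖ ≤ (4 * A ^ 2 + 16) / |y| ∧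
      Gamma (I * y + a) = Real.sqrt (2 * Real.pi)
        * exp ((I * y + a - 1 / 2) * (Real.log |y| + Real.sign y * (Real.pi / 2) * I)
          - I * y + ε) := by
  have hypos : 0 < |y| := by linarith
  have hw : ‖I * (y : ℂ)‖ = |y| := by simp
  have hwre : (I * (y : ℂ)).re = 0 := by simp
  have hsnorm : |y| / 2 ≤ ‖I * (y : ℂ) + a‖ := by
    have := norm_sub_le (I * (y : ℂ) + a) a
    rw [add_sub_cancel_right, hw] at this
    linarith
  have hsre : 0 < (I * (y : ℂ) + a).re := by rw [add_re, hwre, zero_add]; exact hre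
  have hs2 : 2 ≤ ‖I * (y : ℂ) + a‖ := by linarith
  have hmain := norm_stirlingMain_add_sub_le hA (w := I * y) hwre.ge ha (by rw [hw]; exact hyA)
  have htail := norm_tsum_stirlingDefect_le hsre.le hs2
  rw [hw] at hmain
  set ε₁ := stirlingMain (I * y + a) - ((I * y + a - 1 / 2) * log (I * y) - I * y) with hε₁
  set ε₂ := ∑' n : ℕ, stirlingDefect (I * y + a + n)
  refine ⟨ε₁ + ε₂, ?_, ?_⟩
  · calc ‖ε₁ + ε₂‖ ≤ ‖ε₁‖ + ‖ε₂‖ := norm_add_le _ _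
      _ ≤ 4 * A ^ 2 / |y| + 8 / (|y| / 2) := by
        refine add_le_add hmain (htail.trans ?_)
        gcongr
      _ = (4 * A ^ 2 + 16) / |y| := by field_simp; ring
  · rw [Gamma_eq_exp_stirlingMain hsre hs2, ← log_I_mul_ofReal (abs_pos.mp hypos), hε₁]
    congr 2
    ring

lemma Real.sign_div_two (t : ℝ) : Real.sign (t / 2) = Real.sign t := by
  rcases lt_trichotomy t 0 with h | h | h
  · rw [Real.sign_of_neg h, Real.sign_of_neg (by linarith)]
  · simp [h]
  · rw [Real.sign_of_pos h, Real.sign_of_pos (by linarith)]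

/-- Stirling-type asymptotic for the Gamma ratio:
`Γ((1/2 − it − κ)/2) / Γ((1/2 + it − κ)/2) = (|t|/(2e))^{−it} e^{iπ sgn(t)(1/4 + κ/2)} (1 + O(T^{−1}))`
uniformly for `T ≤ |t| ≤ 2T`, `|κ| ≤ B`, `Re κ < 1/2`. -/
theorem gamma_ratio_stirling_reflection (B : ℝ) (hB : 1 ≤ B) :
    ∃ C : ℝ, 0 < C ∧ ∃ T₀ : ℝ, 2 ≤ T₀ ∧
      ∀ T : ℝ, T₀ ≤ T → ∀ t : ℝ, T ≤ |t| → |t| ≤ 2 * T →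
      ∀ κ : ℂ, ‖κ‖ ≤ B → κ.re < 1 / 2 →
      ∃ δ : ℂ, ‖δ‖ ≤ C * T⁻¹ ∧
        Complex.Gamma ((1 / 2 - Complex.I * t - κ) / 2)
            / Complex.Gamma ((1 / 2 + Complex.I * t - κ) / 2)
          = Complex.exp (-(Complex.I * t) * Real.log (|t| / (2 * Real.exp 1)))
              * Complex.exp (Complex.I * Real.pi * (Real.sign t : ℂ) * (1 / 4 + κ / 2))
              * (1 + δ) := by
  refine ⟨2 * (16 * B ^ 2 + 64), by positivity, 16 * B ^ 2 + 64, by nlinarith, ?_⟩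
  intro T hT t hTt _ κ hκ hκre
  have hTpos : 0 < T := by nlinarith
  have htpos : 0 < |t| := by linarith
  set a : ℂ := 1 / 4 - κ / 2 with ha
  have hanorm : ‖a‖ ≤ B := by
    refine (norm_sub_le _ _).trans ?_
    norm_num
    linarith
  have hare : 0 < a.re := by
    have : a.re = 1 / 4 - κ.re / 2 := by simp [ha]
    linarith
  have hy₁ : |-(t / 2)| = |t| / 2 := by rw [abs_neg, abs_div, abs_two]
  have hy₂ : |t / 2| = |t| / 2 := by rw [abs_div, abs_two]
  have hlarge : 2 * B ≤ |t| / 2 := by nlinarith [sq_nonneg (B - 1)]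
  have hfour : 4 ≤ |t| / 2 := by nlinarith [sq_nonneg B]
  obtain ⟨ε₁, hε₁, hG₁⟩ := exists_Gamma_I_mul_add_eq hB hanorm hare (y := -(t / 2))
    (by rwa [hy₁]) (by rwa [hy₁])
  obtain ⟨ε₂, hε₂, hG₂⟩ := exists_Gamma_I_mul_add_eq hB hanorm hare (y := t / 2)
    (by rwa [hy₂]) (by rwa [hy₂])
  rw [hy₁] at hε₁ hG₁
  rw [hy₂] at hε₂ hG₂
  have hε : ‖ε₁ - ε₂‖ ≤ (16 * B ^ 2 + 64) * T⁻¹ := by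
    calc ‖ε₁ - ε₂‖ ≤ ‖ε₁‖ + ‖ε₂‖ := norm_sub_le _ _
      _ ≤ (4 * B ^ 2 + 16) / (|t| / 2) + (4 * B ^ 2 + 16) / (|t| / 2) := add_le_add hε₁ hε₂
      _ = (16 * B ^ 2 + 64) / |t| := by field_simp; ring
      _ ≤ (16 * B ^ 2 + 64) / T := by gcongr
      _ = _ := div_eq_mul_inv _ _
  have hε_one : ‖ε₁ - ε₂‖ ≤ 1 := by
    refine hε.trans ?_
    rw [← div_eq_mul_inv, div_le_one hTpos]
    exact hT
  refine ⟨exp (ε₁ - ε₂) - 1, ?_, ?_⟩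
  · refine (norm_exp_sub_one_le hε_one).trans ?_
    rw [mul_assoc]
    gcongr
  have hs₁ : (1 / 2 - I * t - κ) / 2 = I * ((-(t / 2) : ℝ) : ℂ) + a := by
    rw [ha]; push_cast; ring
  have hs₂ : (1 / 2 + I * t - κ) / 2 = I * ((t / 2 : ℝ) : ℂ) + a := by
    rw [ha]; push_cast; ring
  have hlog : Real.log (|t| / (2 * Real.exp 1)) = Real.log (|t| / 2) - 1 := by
    rw [← div_div, Real.log_div (by positivity) (Real.exp_ne_zero 1), Real.log_exp]
  have hsqrt : (Real.sqrt (2 * Real.pi) : ℂ) ≠ 0 :=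
    ofReal_ne_zero.mpr (Real.sqrt_pos.mpr (by positivity)).ne'
  rw [hs₁, hs₂, hG₁, hG₂, mul_div_mul_left _ _ hsqrt, ← exp_sub, add_sub_cancel, ← exp_add,
    ← exp_add, Real.sign_neg, Real.sign_div_two, hlog]
  congr 1
  rw [ha]
  push_cast
  ring
end

section
/- Fix ε ∈ (0, 1/2) and let V₁ : ℝ → ℝ be a smooth function with support contained in [4/5, 11/5] and |V₁(x)| ≤ 1 for all x. Then there exist C > 0 and T₀ ≥ 2 (possibly depending on ε and V₁) such that for all T ≥ T₀ and all real M with 1 ≤ M ≤ T^{1+ε}: ∫_T^{2T} |∑_{m ≥ 1} d(m) · m^{−1/2 − it} · V₁(m/M)| dt ≤ C·T^{1+ε}. -/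
open MeasureTheory Complex

/-- A nonnegative submultiplicative function weighted by the divisor function is bounded on average
by the square of its partial sum. -/
theorem sum_card_divisors_mul_le_sq {g : ℕ → ℝ} (hg : ∀ n, 0 ≤ g n)
    (hmul : ∀ a b, g (a * b) ≤ g a * g b) (N : ℕ) :
    ∑ m ∈ Finset.Icc 1 N, (m.divisors.card : ℝ) * g m ≤ (∑ m ∈ Finset.Icc 1 N, g m) ^ 2 := by
  have hdisj : Set.PairwiseDisjoint (Finset.Icc 1 N : Set ℕ) Nat.divisorsAntidiagonal := by
    intro a _ b _ hab
    refine Finset.disjoint_left.2 fun p hpa hpb => hab ?_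
    rw [← (Nat.mem_divisorsAntidiagonal.1 hpa).1, ← (Nat.mem_divisorsAntidiagonal.1 hpb).1]
  calc ∑ m ∈ Finset.Icc 1 N, (m.divisors.card : ℝ) * g m
      ≤ ∑ m ∈ Finset.Icc 1 N, ∑ p ∈ m.divisorsAntidiagonal, g p.1 * g p.2 := by
        refine Finset.sum_le_sum fun m _ => ?_
        rw [← Nat.map_div_right_divisors, Finset.sum_map, ← nsmul_eq_mul]
        refine Finset.card_nsmul_le_sum _ _ _ fun d hd => ?_
        have h := hmul d (m / d)
        rwa [Nat.mul_div_cancel' (Nat.dvd_of_mem_divisors hd)] at h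
    _ = ∑ p ∈ (Finset.Icc 1 N).biUnion Nat.divisorsAntidiagonal, g p.1 * g p.2 :=
        (Finset.sum_biUnion hdisj).symm
    _ ≤ ∑ p ∈ Finset.Icc 1 N ×ˢ Finset.Icc 1 N, g p.1 * g p.2 := by
        refine Finset.sum_le_sum_of_subset_of_nonneg ?_ fun p _ _ => mul_nonneg (hg _) (hg _)
        intro p hp
        obtain ⟨m, hm, hp⟩ := Finset.mem_biUnion.1 hp
        obtain ⟨rfl, h0⟩ := Nat.mem_divisorsAntidiagonal.1 hp
        have hN := (Finset.mem_Icc.1 hm).2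
        have h1 : p.1 ≠ 0 := left_ne_zero_of_mul h0
        have h2 : p.2 ≠ 0 := right_ne_zero_of_mul h0
        have h3 := Nat.le_mul_of_pos_right p.1 (Nat.pos_of_ne_zero h2)
        have h4 := Nat.le_mul_of_pos_left p.2 (Nat.pos_of_ne_zero h1)
        simp only [Finset.mem_product, Finset.mem_Icc]
        omega
    _ = (∑ m ∈ Finset.Icc 1 N, g m) ^ 2 := by
        rw [sq, Finset.sum_mul_sum, Finset.sum_product]

theorem card_divisors_mul_le (a b : ℕ) :
    (a * b).divisors.card ≤ a.divisors.card * b.divisors.card := by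
  rw [Nat.divisors_mul]
  exact Finset.card_mul_le

theorem sum_Icc_inv_le_one_add_log (N : ℕ) :
    ∑ m ∈ Finset.Icc 1 N, (m : ℝ)⁻¹ ≤ 1 + Real.log N := by
  have h := harmonic_le_one_add_log N
  rw [harmonic_eq_sum_Icc] at h
  push_cast at h
  exact h

theorem sum_sq_card_divisors_div_le (N : ℕ) :
    ∑ m ∈ Finset.Icc 1 N, (m.divisors.card : ℝ) ^ 2 / m ≤ (1 + Real.log N) ^ 4 := by
  have hinv := sum_card_divisors_mul_le_sq (g := fun n => (n : ℝ)⁻¹) (fun n => by positivity)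
    (fun a b => by push_cast; rw [mul_inv]) N
  have hdiv := sum_card_divisors_mul_le_sq (g := fun n => (n.divisors.card : ℝ) * (n : ℝ)⁻¹)
    (fun n => by positivity) (fun a b => by
      have h : ((a * b).divisors.card : ℝ) ≤ a.divisors.card * b.divisors.card := by
        exact_mod_cast card_divisors_mul_le a b
      push_cast
      calc ((a * b).divisors.card : ℝ) * ((a : ℝ) * b)⁻¹
          ≤ (a.divisors.card * b.divisors.card) * ((a : ℝ) * b)⁻¹ := by gcongr
        _ = _ := by rw [mul_inv]; ring) N
  calc ∑ m ∈ Finset.Icc 1 N, (m.divisors.card : ℝ) ^ 2 / m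
      = ∑ m ∈ Finset.Icc 1 N, (m.divisors.card : ℝ) * (m.divisors.card * (m : ℝ)⁻¹) :=
        Finset.sum_congr rfl fun m _ => by ring
    _ ≤ (∑ m ∈ Finset.Icc 1 N, (m.divisors.card : ℝ) * (m : ℝ)⁻¹) ^ 2 := hdiv
    _ ≤ ((∑ m ∈ Finset.Icc 1 N, (m : ℝ)⁻¹) ^ 2) ^ 2 := by gcongr
    _ ≤ ((1 + Real.log N) ^ 2) ^ 2 := by gcongr; exact sum_Icc_inv_le_one_add_log N
    _ = _ := by ring

theorem sum_inv_abs_sub_le {m N : ℕ} (hm : m ∈ Finset.Icc 1 N) :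
    ∑ n ∈ Finset.Icc 1 N, |(m : ℝ) - n|⁻¹ ≤ 2 * (1 + Real.log N) := by
  have hmN := (Finset.mem_Icc.1 hm).2
  have hlow : ∑ n ∈ Finset.Icc 1 N with n < m, |(m : ℝ) - n|⁻¹
      ≤ ∑ k ∈ Finset.Icc 1 N, (k : ℝ)⁻¹ := by
    rw [Finset.sum_congr rfl (g := fun n => ((m - n : ℕ) : ℝ)⁻¹),
      ← Finset.sum_image (g := fun n => m - n) (f := fun k : ℕ => (k : ℝ)⁻¹)]
    · refine Finset.sum_le_sum_of_subset_of_nonneg ?_ fun _ _ _ => by positivity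
      intro k hk
      simp only [Finset.mem_image, Finset.mem_filter, Finset.mem_Icc] at hk ⊢
      omega
    · intro a ha b hb hab
      simp only [Finset.coe_filter, Set.mem_ofPred_eq] at ha hb hab
      omega
    · intro n hn
      have h := (Finset.mem_filter.1 hn).2.le
      rw [Nat.cast_sub h, abs_of_nonneg (sub_nonneg.2 (by exact_mod_cast h))]
  have hhigh : ∑ n ∈ Finset.Icc 1 N with ¬ n < m, |(m : ℝ) - n|⁻¹
      ≤ ∑ k ∈ Finset.Icc 1 N, (k : ℝ)⁻¹ := by
    rw [Finset.sum_congr rfl (g := fun n => ((n - m : ℕ) : ℝ)⁻¹),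
      ← Finset.sum_image (g := fun n => n - m) (f := fun k : ℕ => (k : ℝ)⁻¹)]
    · rw [← Finset.sum_erase (a := 0) _ (by simp)]
      refine Finset.sum_le_sum_of_subset_of_nonneg ?_ fun _ _ _ => by positivity
      intro k hk
      simp only [Finset.mem_erase, Finset.mem_image, Finset.mem_filter, Finset.mem_Icc] at hk ⊢
      omega
    · intro a ha b hb hab
      simp only [Finset.coe_filter, Set.mem_ofPred_eq] at ha hb hab
      omega
    · intro n hn
      have h := not_lt.1 (Finset.mem_filter.1 hn).2
      rw [Nat.cast_sub h, abs_sub_comm, abs_of_nonneg (sub_nonneg.2 (by exact_mod_cast h))]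
  rw [← Finset.sum_filter_add_sum_filter_not _ (fun n => n < m)]
  linarith [sum_Icc_inv_le_one_add_log N]

theorem abs_integral_cos_mul_le {c : ℝ} (hc : c ≠ 0) (A B : ℝ) :
    |∫ t in A..B, Real.cos (t * c)| ≤ 2 / |c| := by
  rw [intervalIntegral.integral_comp_mul_right _ hc, integral_cos, smul_eq_mul, abs_mul, abs_inv,
    div_eq_inv_mul]
  gcongr
  rw [abs_le]
  constructor <;>
    linarith [Real.sin_le_one (B * c), Real.sin_le_one (A * c), Real.neg_one_le_sin (B * c),
      Real.neg_one_le_sin (A * c)]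

theorem abs_sub_le_mul_abs_log_sub {m n N : ℕ} (hm : m ∈ Finset.Icc 1 N)
    (hn : n ∈ Finset.Icc 1 N) :
    |(m : ℝ) - n| ≤ N * |Real.log m - Real.log n| := by
  wlog h : n ≤ m generalizing m n
  · rw [abs_sub_comm, abs_sub_comm (Real.log m)]
    exact this hn hm (le_of_not_ge h)
  rw [Finset.mem_Icc] at hm hn
  have hm0 : (0 : ℝ) < m := by exact_mod_cast hm.1
  have hn0 : (0 : ℝ) < n := by exact_mod_cast hn.1
  have hnm : (n : ℝ) ≤ m := by exact_mod_cast h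
  have hlog := Real.log_le_log hn0 hnm
  have hmN : (m : ℝ) ≤ N := by exact_mod_cast hm.2
  rw [abs_of_nonneg (sub_nonneg.2 hnm), abs_of_nonneg (sub_nonneg.2 hlog)]
  have hkey := Real.one_sub_inv_le_log_of_pos (div_pos hm0 hn0)
  rw [Real.log_div hm0.ne' hn0.ne', inv_div] at hkey
  calc (m : ℝ) - n = m * (1 - n / m) := by field_simp
    _ ≤ m * (Real.log m - Real.log n) := by gcongr
    _ ≤ N * (Real.log m - Real.log n) := by gcongr

theorem abs_integral_cos_log_sub_le {m n N : ℕ} (hm : m ∈ Finset.Icc 1 N)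
    (hn : n ∈ Finset.Icc 1 N) {A B : ℝ} (hAB : A ≤ B) :
    |∫ t in A..B, Real.cos (t * (Real.log m - Real.log n))|
      ≤ (if m = n then B - A else 0) + 2 * N * |(m : ℝ) - n|⁻¹ := by
  by_cases h : m = n
  · subst h
    simp [abs_of_nonneg (sub_nonneg.2 hAB)]
  have hle := abs_sub_le_mul_abs_log_sub hm hn
  have hpos : 0 < |(m : ℝ) - n| := abs_pos.2 (sub_ne_zero.2 (by exact_mod_cast h))
  have hlog : Real.log m - Real.log n ≠ 0 := by
    intro h0
    rw [h0, abs_zero, mul_zero] at hle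
    exact hle.not_gt hpos
  refine (abs_integral_cos_mul_le hlog A B).trans ?_
  rw [if_neg h, zero_add, ← div_eq_mul_inv, div_le_div_iff₀ (abs_pos.2 hlog) hpos]
  linarith

theorem norm_sq_sum_mul_exp_eq (a : ℕ → ℝ) (s : Finset ℕ) (t : ℝ) :
    ‖∑ m ∈ s, (a m : ℂ) * exp (-I * t * Real.log m)‖ ^ 2
      = ∑ m ∈ s, ∑ n ∈ s, a m * a n * Real.cos (t * (Real.log m - Real.log n)) := by
  have hterm (m : ℕ) : (a m : ℂ) * exp (-I * t * Real.log m)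
      = ⟨a m * Real.cos (t * Real.log m), -(a m * Real.sin (t * Real.log m))⟩ := by
    have : -I * t * Real.log m = ((-(t * Real.log m) : ℝ) : ℂ) * I := by push_cast; ring
    rw [this]
    apply Complex.ext
    · rw [re_ofReal_mul, exp_ofReal_mul_I_re, Real.cos_neg]
    · rw [im_ofReal_mul, exp_ofReal_mul_I_im, Real.sin_neg, mul_neg]
  rw [← normSq_eq_norm_sq, normSq_apply, re_sum, im_sum]
  simp only [hterm]
  rw [Finset.sum_mul_sum, Finset.sum_mul_sum, ← Finset.sum_add_distrib]
  refine Finset.sum_congr rfl fun m _ => ?_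
  rw [← Finset.sum_add_distrib]
  refine Finset.sum_congr rfl fun n _ => ?_
  rw [mul_sub, Real.cos_sub]
  ring

/-- A mean value theorem for Dirichlet polynomials with real coefficients. -/
theorem integral_norm_sq_sum_mul_exp_le (a : ℕ → ℝ) (N : ℕ) {A B : ℝ} (hAB : A ≤ B) :
    ∫ t in A..B, ‖∑ m ∈ Finset.Icc 1 N, (a m : ℂ) * exp (-I * t * Real.log m)‖ ^ 2
      ≤ (B - A + 4 * N * (1 + Real.log N)) * ∑ m ∈ Finset.Icc 1 N, a m ^ 2 := by
  set s := Finset.Icc 1 N with hs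
  set K : ℕ → ℕ → ℝ := fun m n => (if m = n then B - A else 0) + 2 * N * |(m : ℝ) - n|⁻¹ with hK
  have hK0 (m n : ℕ) : 0 ≤ K m n := by
    have := sub_nonneg.2 hAB
    simp only [hK]
    positivity
  have hKcomm (m n : ℕ) : K m n = K n m := by
    simp only [hK, eq_comm (a := m), abs_sub_comm (m : ℝ)]
  have hKsum {m : ℕ} (hm : m ∈ s) : ∑ n ∈ s, K m n ≤ B - A + 4 * N * (1 + Real.log N) := by
    simp only [hK]
    rw [Finset.sum_add_distrib, Finset.sum_ite_eq, if_pos hm, ← Finset.mul_sum]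
    have := mul_le_mul_of_nonneg_left (sum_inv_abs_sub_le hm) (by positivity : (0 : ℝ) ≤ 2 * N)
    linarith
  simp only [norm_sq_sum_mul_exp_eq]
  have hint (m n : ℕ) : IntervalIntegrable
      (fun t => a m * a n * Real.cos (t * (Real.log m - Real.log n))) volume A B :=
    Continuous.intervalIntegrable (by fun_prop) _ _
  rw [intervalIntegral.integral_finsetSum fun m _ => Continuous.intervalIntegrable
    (by fun_prop) _ _]
  calc ∑ m ∈ s, ∫ t in A..B, ∑ n ∈ s, a m * a n * Real.cos (t * (Real.log m - Real.log n))
      ≤ ∑ m ∈ s, ∑ n ∈ s, (a m ^ 2 + a n ^ 2) / 2 * K m n := by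
        refine Finset.sum_le_sum fun m hm => ?_
        rw [intervalIntegral.integral_finsetSum fun n _ => hint m n]
        refine Finset.sum_le_sum fun n hn => ?_
        rw [intervalIntegral.integral_const_mul]
        refine (le_abs_self _).trans ?_
        rw [abs_mul]
        refine mul_le_mul ?_ (abs_integral_cos_log_sub_le hm hn hAB) (abs_nonneg _) (by positivity)
        rw [abs_le]
        constructor <;> nlinarith [sq_nonneg (a m - a n), sq_nonneg (a m + a n)]
    _ = ∑ m ∈ s, ∑ n ∈ s, a m ^ 2 * K m n := by
        have hswap : ∑ m ∈ s, ∑ n ∈ s, a n ^ 2 * K m n = ∑ m ∈ s, ∑ n ∈ s, a m ^ 2 * K m n := by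
          rw [Finset.sum_comm]
          simp only [hKcomm]
        have hsplit : ∑ m ∈ s, ∑ n ∈ s, (a m ^ 2 + a n ^ 2) / 2 * K m n
            = (∑ m ∈ s, ∑ n ∈ s, a m ^ 2 * K m n + ∑ m ∈ s, ∑ n ∈ s, a n ^ 2 * K m n) / 2 := by
          rw [← Finset.sum_add_distrib, Finset.sum_div]
          refine Finset.sum_congr rfl fun m _ => ?_
          rw [← Finset.sum_add_distrib, Finset.sum_div]
          exact Finset.sum_congr rfl fun n _ => by ring
        rw [hsplit, hswap]
        ring
    _ ≤ ∑ m ∈ s, a m ^ 2 * (B - A + 4 * N * (1 + Real.log N)) := by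
        refine Finset.sum_le_sum fun m hm => ?_
        rw [← Finset.mul_sum]
        gcongr
        exact hKsum hm
    _ = _ := by rw [← Finset.sum_mul, mul_comm]

/-- A smoothed Dirichlet series over the divisor function is a finite Dirichlet polynomial. -/
theorem tsum_card_divisors_mul_exp_mul_eq_sum {V : ℝ → ℝ} {b M : ℝ}
    (hV : ∀ x, b < x → V x = 0) (hM : 0 < M) (t : ℝ) :
    ∑' m : ℕ+, (((m : ℕ).divisors.card : ℂ)
        * exp ((-(1 / 2) - I * t) * Real.log (m : ℕ)) * (V (((m : ℕ) : ℝ) / M) : ℂ))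
      = ∑ m ∈ Finset.Icc 1 ⌊b * M⌋₊,
        ((m.divisors.card * Real.exp (-(1 / 2) * Real.log m) * V (m / M) : ℝ) : ℂ)
          * exp (-I * t * Real.log m) := by
  have hterm (m : ℕ) : ((m.divisors.card : ℂ)
        * exp ((-(1 / 2) - I * t) * Real.log m) * (V ((m : ℝ) / M) : ℂ))
      = ((m.divisors.card * Real.exp (-(1 / 2) * Real.log m) * V (m / M) : ℝ) : ℂ)
          * exp (-I * t * Real.log m) := by
    rw [show (-(1 / 2) - I * t) * (Real.log m : ℂ)
      = ((-(1 / 2) * Real.log m : ℝ) : ℂ) + -I * t * Real.log m by push_cast; ring, exp_add,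
      ← ofReal_exp]
    push_cast
    ring
  rw [← Finset.sum_congr rfl fun m _ => hterm m]
  rw [tsum_pnat_eq_tsum_succ (f := fun m : ℕ => ((m.divisors.card : ℂ)
        * exp ((-(1 / 2) - I * t) * Real.log m) * (V ((m : ℝ) / M) : ℂ)))]
  rw [tsum_eq_sum (s := Finset.range ⌊b * M⌋₊), Finset.range_eq_Ico,
    Finset.sum_Ico_add' (fun m : ℕ => ((m.divisors.card : ℂ)
        * exp ((-(1 / 2) - I * t) * Real.log m) * (V ((m : ℝ) / M) : ℂ)))]
  · rfl
  · intro n hn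
    rw [hV, ofReal_zero, mul_zero]
    rw [Finset.mem_range, not_lt] at hn
    rw [lt_div_iff₀ hM]
    exact (Nat.floor_lt' (by omega)).1 (by omega)

theorem integral_norm_le_of_integral_norm_sq_le {f : ℝ → ℂ} (hf : Continuous f) {A B K S : ℝ}
    (hAB : A ≤ B) (hK : 0 < K) (hS : ∫ t in A..B, ‖f t‖ ^ 2 ≤ S) :
    ∫ t in A..B, ‖f t‖ ≤ (S / K + K * (B - A)) / 2 := by
  calc ∫ t in A..B, ‖f t‖ ≤ ∫ t in A..B, (‖f t‖ ^ 2 / (2 * K) + K / 2) := by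
        refine intervalIntegral.integral_mono_on hAB (Continuous.intervalIntegrable (by fun_prop) _ _)
          (Continuous.intervalIntegrable (by fun_prop) _ _) fun t _ => ?_
        rw [div_add_div _ _ (by positivity) two_ne_zero, le_div_iff₀ (by positivity)]
        nlinarith [sq_nonneg (‖f t‖ - K)]
    _ = (∫ t in A..B, ‖f t‖ ^ 2) / (2 * K) + K / 2 * (B - A) := by
        rw [intervalIntegral.integral_add (Continuous.intervalIntegrable (by fun_prop) _ _)
          (Continuous.intervalIntegrable (by fun_prop) _ _), intervalIntegral.integral_div,
          intervalIntegral.integral_const, smul_eq_mul]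
        ring
    _ ≤ S / (2 * K) + K / 2 * (B - A) := by gcongr
    _ = _ := by field_simp

theorem exists_forall_log_pow_le_rpow {ε : ℝ} (hε : 0 < ε) (c : ℝ) (k : ℕ) :
    ∃ T₀ : ℝ, ∀ T ≥ T₀, c * Real.log T ^ k ≤ T ^ ε := by
  have h := ((isLittleO_log_rpow_rpow_atTop (k : ℝ) hε).const_mul_left c).bound one_pos
  obtain ⟨T₀, hT₀⟩ := Filter.eventually_atTop.1 h
  refine ⟨max T₀ 0, fun T hT => ?_⟩
  have := hT₀ T ((le_max_left _ _).trans hT)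
  rw [Real.rpow_natCast, one_mul, Real.norm_of_nonneg
    (Real.rpow_nonneg ((le_max_right _ _).trans hT) ε)] at this
  exact (le_abs_self _).trans this

/-- First-moment bound for a smoothed divisor-sum Dirichlet polynomial: for smooth `V₁`
supported in `[4/5, 11/5]` with `|V₁| ≤ 1`, and `1 ≤ M ≤ T^{1+ε}`,
`∫_T^{2T} |∑_{m≥1} d(m) m^{−1/2−it} V₁(m/M)| dt ≤ C T^{1+ε}`. -/
theorem divisor_dirichlet_polynomial_first_moment
    (ε : ℝ) (hε0 : 0 < ε) (hε1 : ε < 1 / 2)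
    (V₁ : ℝ → ℝ) (hV : ContDiff ℝ (⊤ : ℕ∞) V₁)
    (hVsupp : Function.support V₁ ⊆ Set.Icc (4 / 5) (11 / 5))
    (hVbd : ∀ x : ℝ, |V₁ x| ≤ 1) :
    ∃ C : ℝ, 0 < C ∧ ∃ T₀ : ℝ, 2 ≤ T₀ ∧
      ∀ T : ℝ, T₀ ≤ T → ∀ M : ℝ, 1 ≤ M → M ≤ T ^ (1 + ε) →
      (∫ t in Set.Icc T (2 * T),
          ‖∑' m : ℕ+, (((m : ℕ).divisors.card : ℂ)
            * Complex.exp ((-(1 / 2) - Complex.I * t) * Real.log (m : ℕ))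
            * (V₁ (((m : ℕ) : ℝ) / M) : ℂ))‖)
        ≤ C * T ^ (1 + ε) := by
  obtain ⟨T₁, hT₁⟩ := exists_forall_log_pow_le_rpow hε0 (4 ^ 5) 5
  refine ⟨7, by norm_num, max 3 T₁, le_max_of_le_left (by norm_num), fun T hT M hM hMT => ?_⟩
  have hT3 : 3 ≤ T := (le_max_left _ _).trans hT
  have hlogpow := hT₁ T ((le_max_right _ _).trans hT)
  have hTpos : 0 < T := by linarith
  have hM0 : 0 < M := by linarith
  have hTε : T ≤ T ^ (1 + ε) := Real.self_le_rpow_of_one_le (by linarith) (by linarith)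
  have hzero : ∀ x, 11 / 5 < x → V₁ x = 0 := fun x hx => by
    by_contra h
    exact (hVsupp h).2.not_gt hx
  set N := ⌊11 / 5 * M⌋₊ with hN
  set a : ℕ → ℝ := fun m => m.divisors.card * Real.exp (-(1 / 2) * Real.log m) * V₁ (m / M) with ha
  set L := 1 + Real.log N with hL
  have hN1 : (1 : ℝ) ≤ N := by exact_mod_cast Nat.le_floor (by push_cast; linarith)
  have hN3 : (N : ℝ) ≤ 3 * T ^ (1 + ε) := by
    have := Nat.floor_le (by positivity : 0 ≤ 11 / 5 * M)
    linarith
  have hL1 : 1 ≤ L := by linarith [Real.log_nonneg hN1]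
  have hL0 : 0 ≤ L := zero_le_one.trans hL1
  have hLT : L ≤ 4 * Real.log T := by
    have h3 : 1 ≤ Real.log 3 := by
      rw [Real.le_log_iff_exp_le (by norm_num)]
      linarith [Real.exp_one_lt_d9]
    have h3T : Real.log 3 ≤ Real.log T := Real.log_le_log (by norm_num) hT3
    have hlogN := Real.log_le_log (by linarith) hN3
    rw [Real.log_mul (by norm_num) (by positivity), Real.log_rpow hTpos] at hlogN
    have hεlog : ε * Real.log T ≤ 1 / 2 * Real.log T :=
      mul_le_mul_of_nonneg_right hε1.le (by linarith)
    linarith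
  have hL5 : L ^ 5 ≤ T ^ ε := by
    refine le_trans ?_ hlogpow
    rw [← mul_pow]
    gcongr
  have hsum : ∑ m ∈ Finset.Icc 1 N, a m ^ 2 ≤ L ^ 4 := by
    refine le_trans (Finset.sum_le_sum fun m hm => ?_) (sum_sq_card_divisors_div_le N)
    have hm0 : (0 : ℝ) < m := by exact_mod_cast (Finset.mem_Icc.1 hm).1
    have hexp : Real.exp (-(1 / 2) * Real.log m) ^ 2 = (m : ℝ)⁻¹ := by
      rw [← Real.exp_nat_mul, ← Real.exp_log hm0, ← Real.exp_neg, Real.exp_log hm0]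
      congr 1
      push_cast
      ring
    rw [ha, mul_pow, mul_pow, hexp, ← div_eq_mul_inv]
    exact mul_le_of_le_one_right (by positivity) (by rw [sq_le_one_iff_abs_le_one]; exact hVbd _)
  have hsq := (integral_norm_sq_sum_mul_exp_le a N (by linarith : T ≤ 2 * T)).trans
    (show _ ≤ 13 * T ^ (1 + ε) * T ^ ε from calc
      (2 * T - T + 4 * N * L) * ∑ m ∈ Finset.Icc 1 N, a m ^ 2
          ≤ (13 * T ^ (1 + ε) * L) * L ^ 4 := by
            refine mul_le_mul ?_ hsum (Finset.sum_nonneg fun m _ => sq_nonneg _) (by positivity)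
            have hTL := mul_le_mul hTε hL1 zero_le_one (hTpos.le.trans hTε)
            have hNL := mul_le_mul_of_nonneg_right hN3 hL0
            linarith
        _ = 13 * T ^ (1 + ε) * L ^ 5 := by ring
        _ ≤ _ := by gcongr)
  have hcont : Continuous fun t : ℝ =>
      ∑ m ∈ Finset.Icc 1 N, (a m : ℂ) * exp (-I * t * Real.log m) := by fun_prop
  have hfirst := integral_norm_le_of_integral_norm_sq_le hcont (by linarith)
    (Real.rpow_pos_of_pos hTpos ε) hsq
  simp only [tsum_card_divisors_mul_exp_mul_eq_sum hzero hM0]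
  rw [integral_Icc_eq_integral_Ioc, ← intervalIntegral.integral_of_le (by linarith)]
  refine hfirst.trans (le_of_eq ?_)
  rw [mul_div_assoc, div_self (Real.rpow_pos_of_pos hTpos ε).ne', Real.rpow_add hTpos,
    Real.rpow_one]
  ring
end

section
/- Let W : ℝ → ℂ be a smooth function with compact support contained in (0, ∞), and define Ŵ(y) := ∫_ℝ W(x) e(−xy) dx. Then for every σ ∈ (0, 1) and every natural number j there exists C > 0 such that for all real τ: |∫_0^∞ x^{σ−1+iτ} · Ŵ(x) dx| ≤ C·(1 + |τ|)^{−j}. -/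
open MeasureTheory Complex

open Filter Asymptotics Topology
open scoped SchwartzMap FourierTransform

/-- The Mellin transform of a Schwartz function converges on the right half-plane. -/
theorem SchwartzMap.mellinConvergent (F : 𝓢(ℝ, ℂ)) {s : ℂ} (hs : 0 < s.re) :
    MellinConvergent F s := by
  refine mellinConvergent_of_isBigO_rpow (a := s.re + 1) (b := 0)
    (F.continuous.locallyIntegrable.locallyIntegrableOn _) ?_ (by linarith) ?_ hs
  · refine ((F.isBigO_cocompact_rpow (-(s.re + 1))).mono atTop_le_cocompact).trans_eventuallyEq ?_
    filter_upwards [eventually_ge_atTop 0] with x hx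
    rw [Real.norm_of_nonneg hx]
  · simpa using (F.continuous.tendsto 0).isBigO_one ℝ |>.mono nhdsWithin_le_nhds

/-- The Euler operator `F ↦ x F'` on Schwartz functions. -/
noncomputable def SchwartzMap.euler (F : 𝓢(ℝ, ℂ)) : 𝓢(ℝ, ℂ) :=
  SchwartzMap.smulLeftCLM ℂ Complex.ofReal (SchwartzMap.derivCLM ℝ ℂ F)

theorem SchwartzMap.euler_apply (F : 𝓢(ℝ, ℂ)) (x : ℝ) : F.euler x = x * deriv F x := by
  rw [SchwartzMap.euler, SchwartzMap.smulLeftCLM_apply_apply (by fun_prop),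
    SchwartzMap.derivCLM_apply, smul_eq_mul]

theorem SchwartzMap.tendsto_cpow_mul_atTop (F : 𝓢(ℝ, ℂ)) (s : ℂ) :
    Tendsto (fun x : ℝ => (x : ℂ) ^ s * F x) atTop (𝓝 0) := by
  have hF : F =O[atTop] fun x : ℝ => x ^ (-s.re - 1) := by
    refine ((F.isBigO_cocompact_rpow (-s.re - 1)).mono atTop_le_cocompact).trans_eventuallyEq ?_
    filter_upwards [eventually_ge_atTop 0] with x hx
    rw [Real.norm_of_nonneg hx]
  have hs : (fun x : ℝ => (x : ℂ) ^ s) =O[atTop] fun x : ℝ => x ^ s.re := by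
    refine IsBigO.of_bound 1 ?_
    filter_upwards [eventually_gt_atTop 0] with x hx
    rw [Complex.norm_cpow_eq_rpow_re_of_pos hx, one_mul]
    exact le_abs_self _
  refine ((hs.mul hF).trans_eventuallyEq ?_).trans_tendsto (tendsto_rpow_neg_atTop one_pos)
  filter_upwards [eventually_gt_atTop 0] with x hx
  rw [← Real.rpow_add hx]
  ring_nf

/-- Integration by parts for the Mellin transform of a Schwartz function. -/
theorem SchwartzMap.mul_mellin (F : 𝓢(ℝ, ℂ)) {s : ℂ} (hs : 0 < s.re) :
    s * mellin F s = -mellin F.euler s := by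
  have hs0 : s ≠ 0 := by rintro rfl; simp at hs
  have h1 : IntegrableOn (fun x : ℝ => s * ((x : ℂ) ^ (s - 1) • F x)) (Set.Ioi 0) :=
    (F.mellinConvergent hs).const_mul s
  have h2 : IntegrableOn (fun x : ℝ => (x : ℂ) ^ (s - 1) • F.euler x) (Set.Ioi 0) :=
    F.euler.mellinConvergent hs
  have key := integral_Ioi_of_hasDerivAt_of_tendsto (a := 0)
    (f := fun x : ℝ => (x : ℂ) ^ s * F x) ?_ ?_ (h1.add h2) (F.tendsto_cpow_mul_atTop s)
  · simp only [Pi.add_apply] at key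
    rw [integral_add h1 h2, integral_const_mul] at key
    simp only [ofReal_zero, zero_cpow hs0, zero_mul, sub_zero] at key
    exact eq_neg_of_add_eq_zero_left key
  · exact ((continuousAt_ofReal_cpow_const 0 s (Or.inl hs)).mul
      F.continuous.continuousAt).continuousWithinAt
  · intro x hx
    have hx' : (x : ℂ) ≠ 0 := by exact_mod_cast (Set.mem_Ioi.mp hx).ne'
    have hd := ((hasDerivAt_id (x : ℂ)).cpow_const (c := s)
      (Or.inl (by simpa using hx))).comp_ofReal.mul (F.hasDerivAt x)
    convert! hd using 1
    simp only [Pi.add_apply, smul_eq_mul, F.euler_apply, id, mul_one]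
    rw [cpow_sub _ _ hx', cpow_one]
    field_simp

/-- The Mellin transform of a Schwartz function decays rapidly on vertical lines in the right
half-plane. -/
theorem SchwartzMap.exists_norm_mellin_mul_pow_le {σ : ℝ} (hσ : 0 < σ) (j : ℕ) (F : 𝓢(ℝ, ℂ)) :
    ∃ C : ℝ, ∀ τ : ℝ, ‖mellin F (σ + I * τ)‖ * (1 + |τ|) ^ j ≤ C := by
  induction j generalizing F with
  | zero =>
    refine ⟨∫ x in Set.Ioi (0 : ℝ), x ^ (σ - 1) * ‖F x‖, fun τ => ?_⟩
    rw [pow_zero, mul_one]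
    refine (norm_integral_le_integral_norm _).trans_eq
      (setIntegral_congr_fun measurableSet_Ioi fun x hx => ?_)
    simp [Complex.norm_cpow_eq_rpow_re_of_pos hx]
  | succ j ih =>
    obtain ⟨C, hC⟩ := ih F.euler
    refine ⟨(σ⁻¹ + 1) * C, fun τ => ?_⟩
    set s : ℂ := σ + I * τ with hs
    have hre : s.re = σ := by simp [hs]
    have him : s.im = τ := by simp [hs]
    have hσs : σ ≤ ‖s‖ := hre ▸ re_le_norm s
    have hτs : |τ| ≤ ‖s‖ := him ▸ abs_im_le_norm s
    have hle : 1 + |τ| ≤ (σ⁻¹ + 1) * ‖s‖ := by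
      have : 1 ≤ σ⁻¹ * ‖s‖ := by
        rw [inv_mul_eq_div]
        exact (one_le_div hσ).2 hσs
      linarith
    have hparts : ‖s‖ * ‖mellin F s‖ = ‖mellin F.euler s‖ := by
      rw [← norm_mul, F.mul_mellin (hre ▸ hσ), norm_neg]
    calc ‖mellin F s‖ * (1 + |τ|) ^ (j + 1)
        = ‖mellin F s‖ * (1 + |τ|) ^ j * (1 + |τ|) := by ring
      _ ≤ ‖mellin F s‖ * (1 + |τ|) ^ j * ((σ⁻¹ + 1) * ‖s‖) := by gcongr
      _ = (σ⁻¹ + 1) * (‖mellin F.euler s‖ * (1 + |τ|) ^ j) := by rw [← hparts]; ring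
      _ ≤ (σ⁻¹ + 1) * C := by gcongr; exact hC τ

/-- Rapid decay of the Mellin transform of the Fourier transform of a smooth compactly
supported function on `(0, ∞)`: for `W` smooth with compact support in `(0, ∞)`,
`Ŵ(y) = ∫ W(x) e(−xy) dx`, every `σ ∈ (0,1)` and every `j ∈ ℕ`, there is `C > 0` with
`|∫_0^∞ x^{σ−1+iτ} Ŵ(x) dx| ≤ C (1 + |τ|)^{−j}` for all real `τ`. -/
theorem mellin_of_fourier_rapid_decay
    (W : ℝ → ℂ) (hW : ContDiff ℝ (⊤ : ℕ∞) W) (hWc : HasCompactSupport W)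
    (hWsupp : Function.support W ⊆ Set.Ioi (0 : ℝ)) :
    ∀ σ ∈ Set.Ioo (0 : ℝ) 1, ∀ j : ℕ, ∃ C : ℝ, 0 < C ∧ ∀ τ : ℝ,
      ‖∫ x in Set.Ioi (0 : ℝ),
          Complex.exp (((σ : ℂ) - 1 + Complex.I * τ) * Real.log x)
            * ∫ y : ℝ, W y * Complex.exp (-(2 * Real.pi * Complex.I) * (y * x))‖
        ≤ C / (1 + |τ|) ^ j := by
  intro σ hσ j
  obtain ⟨C, hC⟩ :=
    (𝓕 (hWc.toSchwartzMap hW) : 𝓢(ℝ, ℂ)).exists_norm_mellin_mul_pow_le hσ.1 j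
  refine ⟨max C 1, lt_max_of_lt_right one_pos, fun τ => ?_⟩
  rw [le_div_iff₀ (by positivity)]
  refine le_trans (le_of_eq ?_) ((hC τ).trans (le_max_left _ _))
  congr 2
  refine setIntegral_congr_fun measurableSet_Ioi fun x hx => ?_
  have hx' : (x : ℂ) ≠ 0 := by exact_mod_cast (Set.mem_Ioi.mp hx).ne'
  simp only [smul_eq_mul]
  congr 1
  · rw [cpow_def_of_ne_zero hx', ofReal_log (Set.mem_Ioi.mp hx).le]
    ring_nf
  · rw [SchwartzMap.fourier_coe, Real.fourier_real_eq_integral_exp_smul]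
    refine integral_congr_ae (ae_of_all _ fun y => ?_)
    simp only [HasCompactSupport.toSchwartzMap_toFun, smul_eq_mul, mul_comm (W y)]
    congr 2
    push_cast
    ring
end
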